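/- Let d = d' + d'', γ' ∈ [0,∞)^{d'} and z' = (z₁,…,z_{d'}) ∈ 𝕋^{(d')}. Write points of ℝ^d₊ as t = (t', t'') with t' ∈ ℝ^{d'}₊, t'' ∈ ℝ^{d''}₊. Then for every f ∈ S(ℝ^d₊) the partial transform J^{(d')}_{z',γ'} f belongs to S(ℝ^d₊), and for all multi-indices p = (p', p'') and k = (k', k'') in ℕ₀^{d'} × ℕ₀^{d''}: ‖ t'^{(p'+k'+γ')/2} t''^{(p''+k'')/2} D^p_t f(t) ‖_{L²(ℝ^d₊)} = (∏_{l=1}^{d'} |1−z_l|^{−p_l+k_l}) · ‖ t'^{(p'+k'+γ')/2} t''^{(p''+k'')/2} D^{k'}_{t'} D^{p''}_{t''} (J^{(d')}_{z',γ'} f)(t) ‖_{L²(ℝ^d₊)}. -/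

import Mathlib

open MeasureTheory Filter Finset

noncomputable section

def Rpos (d : ℕ) : Set (Fin d → ℝ) := {x | ∀ i, 0 < x i}

def pd {d : ℕ} (i : Fin d) (f : (Fin d → ℝ) → ℂ) : (Fin d → ℝ) → ℂ :=
  fun x => fderiv ℝ f x (Pi.single i 1)

def mderiv {d : ℕ} (p : Fin d → ℕ) (f : (Fin d → ℝ) → ℂ) : (Fin d → ℝ) → ℂ :=
  ((List.ofFn fun i : Fin d => (fun g => (pd i)^[p i] g)).foldr (· ∘ ·) id) f

/-- The space `S(ℝ^d₊)`. -/
def IsSPlus {d : ℕ} (f : (Fin d → ℝ) → ℂ) : Prop :=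
  ContDiffOn ℝ (⊤ : ℕ∞) f (Rpos d) ∧
  (∀ p : Fin d → ℕ, ∃ g : (Fin d → ℝ) → ℂ,
    ContinuousOn g {x | ∀ i, 0 ≤ x i} ∧ ∀ x ∈ Rpos d, g x = mderiv p f x) ∧
  (∀ k p : Fin d → ℕ, ∃ C : ℝ, ∀ x ∈ Rpos d,
    (∏ i, x i ^ k i) * ‖mderiv p f x‖ ≤ C)

/-- The entire function `K_γ(u) = ∑ u^k/(k! Γ(k+γ+1))`. -/
def Kfun (γ : ℝ) (u : ℂ) : ℂ :=
  ∑' k : ℕ, u ^ k / ((k.factorial : ℂ) * Complex.Gamma ((k : ℂ) + (γ : ℂ) + 1))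

/-- Modified fractional power of the partial Hankel-Clifford transform in the first `d'`
variables. -/
def Jpart {d' d'' : ℕ} (z : Fin d' → ℂ) (γ : Fin d' → ℝ)
    (f : (Fin (d' + d'') → ℝ) → ℂ) : (Fin (d' + d'') → ℝ) → ℂ :=
  fun t => (∏ l, (1 - z l) ^ ((-1 : ℂ) - (γ l : ℂ))) *
    ∫ x in Rpos d', f (Fin.append x (fun i => t (Fin.natAdd d' i))) *
      ∏ l, ((x l : ℂ) ^ ((γ l : ℂ)) *
        Kfun (γ l) ((x l : ℂ) * (t (Fin.castAdd d'' l) : ℂ) * z l / (1 - z l)^2))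

/-- The weight `t'^{(p'+k'+γ')/2} t''^{(p''+k'')/2}`. -/
def wt {d' d'' : ℕ} (γ : Fin d' → ℝ) (p k : Fin (d' + d'') → ℕ)
    (t : Fin (d' + d'') → ℝ) : ℝ :=
  (∏ l : Fin d', t (Fin.castAdd d'' l) ^
      (((p (Fin.castAdd d'' l) : ℝ) + (k (Fin.castAdd d'' l) : ℝ) + γ l) / 2)) *
  (∏ l : Fin d'', t (Fin.natAdd d' l) ^
      (((p (Fin.natAdd d' l) : ℝ) + (k (Fin.natAdd d' l) : ℝ)) / 2))

/-- The real kernel `u ↦ K_γ(-u)`. -/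
def bk (γ u : ℝ) : ℝ := ∑' k : ℕ, (-u) ^ k / ((k.factorial : ℝ) * Real.Gamma (k + γ + 1))

lemma Gamma_add_nat_ge {γ : ℝ} (hγ : 0 ≤ γ) (k : ℕ) :
    Real.Gamma (γ + 1) ≤ Real.Gamma (k + γ + 1) := by
  induction k with
  | zero => simp
  | succ k ih =>
    have h : ((k + 1 : ℕ) : ℝ) + γ + 1 = (k + γ + 1) + 1 := by push_cast; ring
    have hp : (0 : ℝ) < k + γ + 1 := by positivity
    rw [h, Real.Gamma_add_one hp.ne']
    have := Real.Gamma_pos_of_pos hp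
    nlinarith [Nat.cast_nonneg (α := ℝ) k]

lemma Gamma_add_nat_pos {γ : ℝ} (hγ : 0 ≤ γ) (k : ℕ) : 0 < Real.Gamma (k + γ + 1) :=
  Real.Gamma_pos_of_pos (by positivity)

lemma norm_bk_term_le {γ : ℝ} (hγ : 0 ≤ γ) {u R : ℝ} (hu : |u| ≤ R) (k : ℕ) :
    ‖(-u) ^ k / ((k.factorial : ℝ) * Real.Gamma (k + γ + 1))‖
      ≤ (Real.Gamma (γ + 1))⁻¹ * (R ^ k / k.factorial) := by
  have h0 : 0 < Real.Gamma (γ + 1) := Real.Gamma_pos_of_pos (by positivity)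
  have h1 := Gamma_add_nat_ge hγ k
  have hR : 0 ≤ R := (abs_nonneg u).trans hu
  rw [norm_div, norm_pow, norm_neg, Real.norm_eq_abs, Real.norm_eq_abs,
    abs_of_pos (mul_pos (by positivity) (h0.trans_le h1)), ← div_eq_inv_mul, div_div]
  gcongr

lemma summable_bk {γ : ℝ} (hγ : 0 ≤ γ) (u : ℝ) :
    Summable fun k : ℕ => (-u) ^ k / ((k.factorial : ℝ) * Real.Gamma (k + γ + 1)) :=
  .of_norm_bounded ((Real.summable_pow_div_factorial |u|).mul_left _)
    (norm_bk_term_le hγ le_rfl)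

lemma Kfun_neg_ofReal (γ u : ℝ) : Kfun γ (-(u : ℂ)) = (bk γ u : ℂ) := by
  unfold Kfun bk
  rw [Complex.ofReal_tsum]
  refine tsum_congr fun k => ?_
  push_cast [← Complex.Gamma_ofReal]
  rfl

lemma hasDerivAt_bk {γ : ℝ} (hγ : 0 ≤ γ) (u : ℝ) : HasDerivAt (bk γ) (-bk (γ + 1) u) u := by
  have key := hasDerivAt_tsum_of_isPreconnected (𝕜 := ℝ)
    (g := fun (k : ℕ) (u : ℝ) => (-u) ^ k / ((k.factorial : ℝ) * Real.Gamma (k + γ + 1)))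
    (g' := fun (k : ℕ) (u : ℝ) =>
      -((k : ℝ) * (-u) ^ (k - 1)) / ((k.factorial : ℝ) * Real.Gamma (k + γ + 1)))
    (u := fun k : ℕ => (Real.Gamma (γ + 1))⁻¹ * (k * (|u| + 1) ^ (k - 1) / k.factorial))
    (t := Metric.ball 0 (|u| + 1)) (y₀ := u) (y := u) ?_ Metric.isOpen_ball
    (convex_ball _ _).isPreconnected ?_ ?_ (by simp) (summable_bk hγ u) (by simp)
  · refine HasDerivAt.congr_deriv (f := bk γ) key ?_
    rw [← Summable.sum_add_tsum_nat_add 1]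
    · unfold bk
      simp only [Finset.sum_range_one, Nat.cast_zero, zero_mul, neg_zero, zero_div, zero_add]
      rw [← tsum_neg]
      refine tsum_congr fun k => ?_
      have h := (Gamma_add_nat_pos hγ (k + 1)).ne'
      have h2 : (k : ℝ) + (γ + 1) + 1 = ((k + 1 : ℕ) : ℝ) + γ + 1 := by push_cast; ring
      rw [h2, Nat.factorial_succ]
      have h3 : (k.factorial : ℝ) ≠ 0 := by positivity
      simp only [Nat.add_sub_cancel]
      push_cast at h ⊢
      field_simp
    · rw [← summable_nat_add_iff 1]
      refine ((summable_bk (add_nonneg hγ zero_le_one) u).neg).congr fun k => ?_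
      have h := (Gamma_add_nat_pos hγ (k + 1)).ne'
      have h2 : (k : ℝ) + (γ + 1) + 1 = ((k + 1 : ℕ) : ℝ) + γ + 1 := by push_cast; ring
      rw [h2, Nat.factorial_succ]
      have h3 : (k.factorial : ℝ) ≠ 0 := by positivity
      simp only [Nat.add_sub_cancel]
      push_cast at h ⊢
      field_simp
  · refine Summable.mul_left _ ?_
    rw [← summable_nat_add_iff 1]
    refine (Real.summable_pow_div_factorial (|u| + 1)).congr fun k => ?_
    rw [Nat.factorial_succ]
    have h3 : (k.factorial : ℝ) ≠ 0 := by positivity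
    simp only [Nat.add_sub_cancel]
    push_cast
    field_simp
  · intro k y _
    have := (((hasDerivAt_id y).neg).pow k).div_const
      ((k.factorial : ℝ) * Real.Gamma (k + γ + 1))
    convert! this using 1
    simp
  · intro k y hy
    have hy' : |y| ≤ |u| + 1 := by simpa using (Metric.mem_ball.1 hy).le
    have h0 : 0 < Real.Gamma (γ + 1) := Real.Gamma_pos_of_pos (by positivity)
    have h1 := Gamma_add_nat_ge hγ k
    rw [norm_div, norm_neg, norm_mul, norm_pow, norm_neg, Real.norm_eq_abs, Real.norm_eq_abs,
      Real.norm_eq_abs, abs_of_pos (mul_pos (by positivity) (h0.trans_le h1)), ← div_eq_inv_mul,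
      div_div, Nat.abs_cast]
    gcongr

lemma continuous_bk {γ : ℝ} (hγ : 0 ≤ γ) : Continuous (bk γ) :=
  continuous_iff_continuousAt.2 fun u => (hasDerivAt_bk hγ u).continuousAt

/-- Recurrence of the kernels, equivalent to the Bessel–Clifford equation. -/
lemma bk_recurrence {γ : ℝ} (hγ : 0 ≤ γ) (u : ℝ) :
    (γ + 1) * bk (γ + 1) u - u * bk (γ + 2) u = bk γ u := by
  have s0 := summable_bk hγ u
  have s1 := summable_bk (add_nonneg hγ zero_le_one) u
  have s2 := summable_bk (add_nonneg hγ zero_le_two) u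
  have e1 : ∀ k : ℕ, (γ + 1) * ((-u) ^ k / ((k.factorial : ℝ) * Real.Gamma (k + (γ + 1) + 1)))
      = (-u) ^ k / ((k.factorial : ℝ) * Real.Gamma (k + γ + 1))
        - k * ((-u) ^ k / ((k.factorial : ℝ) * Real.Gamma (k + (γ + 1) + 1))) := by
    intro k
    have hp : (k : ℝ) + γ + 1 ≠ 0 := by positivity
    have h2 : (k : ℝ) + (γ + 1) + 1 = (k + γ + 1) + 1 := by ring
    rw [h2, Real.Gamma_add_one hp]
    have := (Gamma_add_nat_pos hγ k).ne'
    field_simp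
    ring
  have e2 : ∀ k : ℕ, ((k + 1 : ℕ) : ℝ) * ((-u) ^ (k + 1) /
      (((k + 1).factorial : ℝ) * Real.Gamma ((k + 1 : ℕ) + (γ + 1) + 1)))
      = (-u) * ((-u) ^ k / ((k.factorial : ℝ) * Real.Gamma (k + (γ + 2) + 1))) := by
    intro k
    have h2 : ((k + 1 : ℕ) : ℝ) + (γ + 1) + 1 = k + (γ + 2) + 1 := by push_cast; ring
    rw [h2, Nat.factorial_succ]
    have := (Gamma_add_nat_pos (add_nonneg hγ zero_le_two) k).ne'
    push_cast
    field_simp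
    ring
  have hsum : Summable fun k : ℕ =>
      (k : ℝ) * ((-u) ^ k / ((k.factorial : ℝ) * Real.Gamma (k + (γ + 1) + 1))) := by
    rw [← summable_nat_add_iff 1]
    exact (s2.mul_left (-u)).congr fun k => (e2 k).symm
  have e3 : ∑' k : ℕ, (k : ℝ) * ((-u) ^ k / ((k.factorial : ℝ) * Real.Gamma (k + (γ + 1) + 1)))
      = -u * bk (γ + 2) u := by
    rw [← hsum.sum_add_tsum_nat_add 1, tsum_congr e2, tsum_mul_left]
    simp [bk]
  have e4 : (γ + 1) * bk (γ + 1) u = bk γ u - -u * bk (γ + 2) u := by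
    rw [← e3]
    unfold bk
    rw [← tsum_mul_left, ← s0.tsum_sub hsum]
    exact tsum_congr e1
  linarith

/-- The kernel is bounded on the half line: the energy `u y'² + y²` decreases. -/
lemma abs_bk_le {γ : ℝ} (hγ : 0 ≤ γ) {u : ℝ} (hu : 0 ≤ u) : |bk γ u| ≤ |bk γ 0| := by
  let E : ℝ → ℝ := fun u => u * bk (γ + 1) u ^ 2 + bk γ u ^ 2
  have hE : ∀ u, HasDerivAt E (-(2 * γ + 1) * bk (γ + 1) u ^ 2) u := by
    intro u
    have h1 := hasDerivAt_bk (add_nonneg hγ zero_le_one) u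
    have h0 := hasDerivAt_bk hγ u
    convert! ((hasDerivAt_id u).mul (h1.pow 2)).add (h0.pow 2) using 1
    have := bk_recurrence hγ u
    have h2 : γ + 1 + 1 = γ + 2 := by ring
    simp only [h2, id, Pi.pow_apply]
    rw [← this]
    ring
  have hanti : Antitone E := antitone_of_hasDerivAt_nonpos hE fun u => by
    rw [Pi.zero_apply]
    have := sq_nonneg (bk (γ + 1) u)
    nlinarith
  have h := hanti hu
  simp only [E, zero_mul, zero_add] at h
  refine sq_le_sq.1 ?_
  nlinarith [mul_nonneg hu (sq_nonneg (bk (γ + 1) u))]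

lemma integrableOn_rpow_mul_exp {γ b : ℝ} (hγ : 0 ≤ γ) (hb : 0 < b) :
    IntegrableOn (fun x : ℝ => x ^ γ * Real.exp (-(b * x))) (Set.Ioi 0) := by
  have := integrableOn_rpow_mul_exp_neg_mul_rpow (p := 1) (s := γ) (by linarith) one_pos hb
  refine this.congr_fun (fun x _ => ?_) measurableSet_Ioi
  simp

lemma measurable_ofReal_rpow (γ : ℝ) : Measurable fun x : ℝ => ((x ^ γ : ℝ) : ℂ) :=
  Complex.measurable_ofReal.comp (measurable_id.pow_const γ)

lemma norm_rpow_mul_cexp {γ x : ℝ} (hx : 0 < x) (r : ℂ) :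
    ‖((x ^ γ : ℝ) : ℂ) * Complex.exp (-(r * x))‖ = x ^ γ * Real.exp (-(r.re * x)) := by
  rw [norm_mul, Complex.norm_real, Complex.norm_exp, Real.norm_of_nonneg (by positivity)]
  simp

lemma integrableOn_rpow_mul_cexp {γ : ℝ} (hγ : 0 ≤ γ) {r : ℂ} (hr : 0 < r.re) :
    IntegrableOn (fun x : ℝ => ((x ^ γ : ℝ) : ℂ) * Complex.exp (-(r * x))) (Set.Ioi 0) := by
  refine Integrable.mono' (integrableOn_rpow_mul_exp hγ hr) ?_ ?_
  · exact ((measurable_ofReal_rpow γ).mul (by fun_prop)).aestronglyMeasurable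
  · filter_upwards [ae_restrict_mem measurableSet_Ioi] with x hx
    exact (norm_rpow_mul_cexp hx r).le

lemma hasDerivAt_integral_rpow_mul_cexp {γ : ℝ} (hγ : 0 ≤ γ) {r : ℂ} (hr : 0 < r.re) :
    DifferentiableAt ℂ (fun r : ℂ =>
      ∫ x in Set.Ioi (0 : ℝ), ((x ^ γ : ℝ) : ℂ) * Complex.exp (-(r * x))) r := by
  have hs : {w : ℂ | r.re / 2 < w.re} ∈ nhds r :=
    (isOpen_lt continuous_const Complex.continuous_re).mem_nhds
      (show r.re / 2 < r.re by linarith)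
  refine (hasDerivAt_integral_of_dominated_loc_of_deriv_le (𝕜 := ℂ) hs
    (F := fun w (x : ℝ) => ((x ^ γ : ℝ) : ℂ) * Complex.exp (-(w * x)))
    (F' := fun w (x : ℝ) => ((x ^ γ : ℝ) : ℂ) * (Complex.exp (-(w * x)) * (-x)))
    (bound := fun x : ℝ => x ^ (γ + 1) * Real.exp (-(r.re / 2 * x)))
    (.of_forall fun w => ((measurable_ofReal_rpow γ).mul (by fun_prop)).aestronglyMeasurable)
    (integrableOn_rpow_mul_cexp hγ hr)
    ((measurable_ofReal_rpow γ).mul (by fun_prop)).aestronglyMeasurable ?_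
    (integrableOn_rpow_mul_exp (by linarith) (by linarith)) ?_).2.differentiableAt
  · filter_upwards [ae_restrict_mem measurableSet_Ioi] with x hx w hw
    have hx : 0 < x := hx
    have hw : r.re / 2 < w.re := hw
    rw [← mul_assoc, norm_mul, norm_rpow_mul_cexp hx, norm_neg, Complex.norm_real,
      Real.norm_of_nonneg hx.le, Real.rpow_add_one hx.ne', mul_right_comm]
    gcongr
  · refine .of_forall fun x w _ => ?_
    have h : HasDerivAt (fun w : ℂ => -(w * x)) (-x : ℂ) w := by
      convert! ((hasDerivAt_id w).mul_const (x : ℂ)).neg using 1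
      simp
    exact h.cexp.const_mul _

/-- The Gamma integral with a complex rate. -/
lemma integral_rpow_mul_cexp {γ : ℝ} (hγ : 0 ≤ γ) {r : ℂ} (hr : 0 < r.re) :
    ∫ x in Set.Ioi (0 : ℝ), ((x ^ γ : ℝ) : ℂ) * Complex.exp (-(r * x))
      = r ^ (-((γ : ℂ) + 1)) * (Real.Gamma (γ + 1) : ℂ) := by
  have hU : IsOpen {w : ℂ | 0 < w.re} := isOpen_lt continuous_const Complex.continuous_re
  refine AnalyticOnNhd.eqOn_of_preconnected_of_frequently_eq (𝕜 := ℂ)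
    (f := fun r : ℂ => ∫ x in Set.Ioi (0 : ℝ), ((x ^ γ : ℝ) : ℂ) * Complex.exp (-(r * x)))
    (g := fun r : ℂ => r ^ (-((γ : ℂ) + 1)) * (Real.Gamma (γ + 1) : ℂ))
    (U := {w : ℂ | 0 < w.re}) (z₀ := 1) ?_ ?_ ?_ (by simp) ?_ hr
  · exact DifferentiableOn.analyticOnNhd (fun w hw =>
      (hasDerivAt_integral_rpow_mul_cexp hγ hw).differentiableWithinAt) hU
  · refine DifferentiableOn.analyticOnNhd (fun w hw => ?_) hU
    exact ((differentiableAt_id.cpow_const (Or.inl hw)).mul_const _).differentiableWithinAt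
  · exact (convex_halfSpace_re_gt 0).isPreconnected
  · have h1 : ∃ᶠ x : ℝ in nhdsWithin 1 {1}ᶜ, 0 < x :=
      ((eventually_gt_nhds one_pos).filter_mono nhdsWithin_le_nhds).frequently
    have ht : Tendsto (fun x : ℝ => (x : ℂ)) (nhdsWithin 1 {1}ᶜ) (nhdsWithin 1 {1}ᶜ) := by
      refine tendsto_nhdsWithin_iff.2 ⟨?_, ?_⟩
      · exact (Complex.continuous_ofReal.tendsto' (1 : ℝ) (1 : ℂ) (by simp)).mono_left
          nhdsWithin_le_nhds
      · filter_upwards [self_mem_nhdsWithin] with x hx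
        simpa using hx
    refine ht.frequently (h1.mono fun x hx => ?_)
    have h := Real.integral_rpow_mul_exp_neg_mul_Ioi (a := γ + 1) (r := x) (by linarith) hx
    have h2 := congrArg (fun y : ℝ => (y : ℂ)) h
    simp only [add_sub_cancel_right] at h2
    rw [← integral_complex_ofReal] at h2
    calc _ = _ := by
          refine (integral_congr_ae (.of_forall fun y => ?_)).trans h2
          push_cast
          rfl
      _ = _ := by
        rw [Complex.ofReal_mul, one_div, Real.inv_rpow hx.le, ← Real.rpow_neg hx.le,
          Complex.ofReal_cpow hx.le]
        push_cast
        rfl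

/-- The one-dimensional Hankel–Clifford transform of an exponential. -/
lemma integral_rpow_mul_bk_mul_cexp {γ s : ℝ} (hγ : 0 ≤ γ) {r : ℂ} (hr : 0 < r.re) :
    ∫ x in Set.Ioi (0 : ℝ), ((x ^ γ * bk γ (s * x) : ℝ) : ℂ) * Complex.exp (-(r * x))
      = r ^ (-((γ : ℂ) + 1)) * Complex.exp (-(s / r)) := by
  have hr0 : r ≠ 0 := by rintro rfl; simp at hr
  let F : ℕ → ℝ → ℂ := fun k x =>
    (((-s) ^ k / (k.factorial * Real.Gamma (k + γ + 1)) : ℝ) : ℂ) *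
      (((x ^ (k + γ) : ℝ) : ℂ) * Complex.exp (-(r * x)))
  have hkγ : ∀ k : ℕ, (0 : ℝ) ≤ k + γ := fun k => by positivity
  have hFint : ∀ k, Integrable (F k) (volume.restrict (Set.Ioi 0)) := fun k =>
    (integrableOn_rpow_mul_cexp (hkγ k) hr).const_mul _
  have hnorm : ∀ k, ∫ x in Set.Ioi (0 : ℝ), ‖F k x‖ =
      (r.re ^ (-(γ + 1))) * ((|s| / r.re) ^ k / k.factorial) := by
    intro k
    have h := Real.integral_rpow_mul_exp_neg_mul_Ioi (a := k + γ + 1) (r := r.re)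
      (by positivity) hr
    simp only [add_sub_cancel_right] at h
    have hG := Gamma_add_nat_pos hγ k
    calc _ = ∫ x in Set.Ioi (0 : ℝ), (|s| ^ k / (k.factorial * Real.Gamma (k + γ + 1))) *
          (x ^ ((k : ℝ) + γ) * Real.exp (-(r.re * x))) := by
          refine setIntegral_congr_fun measurableSet_Ioi fun x hx => ?_
          simp only [F]
          rw [norm_mul, norm_rpow_mul_cexp hx, Complex.norm_real, norm_div, norm_pow, norm_neg,
            Real.norm_eq_abs, Real.norm_of_nonneg (by positivity)]
      _ = _ := by
        rw [integral_const_mul, h, one_div, Real.inv_rpow hr.le, ← Real.rpow_neg hr.le,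
          show -((k : ℝ) + γ + 1) = -(γ + 1) - k by ring, Real.rpow_sub hr, Real.rpow_natCast,
          div_pow]
        field_simp
  have hsum : Summable fun k => ∫ x in Set.Ioi (0 : ℝ), ‖F k x‖ := by
    simp_rw [hnorm]
    exact (Real.summable_pow_div_factorial _).mul_left _
  have key := hasSum_integral_of_summable_integral_norm hFint hsum
  have hval : ∀ k, ∫ x in Set.Ioi (0 : ℝ), F k x
      = r ^ (-((γ : ℂ) + 1)) * ((-(s / r)) ^ k / k.factorial) := by
    intro k
    have hG : (Real.Gamma (k + γ + 1) : ℂ) ≠ 0 :=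
      Complex.ofReal_ne_zero.2 (Gamma_add_nat_pos hγ k).ne'
    simp only [F]
    rw [integral_const_mul, integral_rpow_mul_cexp (hkγ k) hr,
      show -((((k : ℝ) + γ : ℝ) : ℂ) + 1) = -((γ : ℂ) + 1) - k by push_cast; ring,
      Complex.cpow_sub _ _ hr0, Complex.cpow_natCast]
    push_cast
    rw [← neg_div, div_pow]
    field_simp
  have hexp := (NormedSpace.expSeries_div_hasSum_exp (𝔸 := ℂ) (-(s / r))).mul_left
    (r ^ (-((γ : ℂ) + 1)))
  rw [← Complex.exp_eq_exp_ℂ] at hexp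
  simp_rw [hval] at key
  rw [← key.unique hexp]
  refine setIntegral_congr_fun measurableSet_Ioi fun x hx => ?_
  have hx : 0 < x := hx
  simp only [F, bk]
  rw [Complex.ofReal_mul, Complex.ofReal_tsum, ← tsum_mul_left, ← tsum_mul_right]
  refine tsum_congr fun k => ?_
  rw [Real.rpow_add hx, Real.rpow_natCast, ← neg_mul, mul_pow]
  push_cast
  ring

lemma inversion_constant {γ c : ℝ} (hc : 0 < c) {r : ℂ} (hr : 0 < r.re) :
    r ^ (-((γ : ℂ) + 1)) * ((c : ℂ) / r) ^ (-((γ : ℂ) + 1)) = ((c ^ (-(γ + 1)) : ℝ) : ℂ) := by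
  have hr0 : r ≠ 0 := by rintro rfl; simp at hr
  have harg : r.arg ≠ Real.pi := by
    intro h
    have := Complex.arg_eq_pi_iff.1 h
    linarith [this.1]
  have hc0 : (c : ℂ) ≠ 0 := Complex.ofReal_ne_zero.2 hc.ne'
  rw [div_eq_mul_inv, Complex.cpow_def_of_ne_zero (mul_ne_zero hc0 (inv_ne_zero hr0)),
    Complex.log_ofReal_mul hc (inv_ne_zero hr0), Complex.log_inv _ harg,
    Complex.cpow_def_of_ne_zero hr0, ← Complex.exp_add, Complex.ofReal_cpow hc.le,
    Complex.cpow_def_of_ne_zero hc0, Complex.ofReal_log hc.le]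
  congr 1
  push_cast
  ring

lemma Rpos_eq_pi (m : ℕ) : Rpos m = Set.pi Set.univ fun _ : Fin m => Set.Ioi (0 : ℝ) := by
  ext x; simp [Rpos]

lemma isOpen_Rpos (m : ℕ) : IsOpen (Rpos m) := by
  rw [Rpos_eq_pi]
  exact isOpen_set_pi Set.finite_univ fun _ _ => isOpen_Ioi

lemma measurableSet_Rpos (m : ℕ) : MeasurableSet (Rpos m) := (isOpen_Rpos m).measurableSet

lemma restrict_Rpos (m : ℕ) : (volume : Measure (Fin m → ℝ)).restrict (Rpos m) =
    Measure.pi fun _ => volume.restrict (Set.Ioi 0) := by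
  rw [Rpos_eq_pi, volume_pi, Measure.restrict_pi_pi]

/-- The power weight `∏ x_l^{γ_l}`. -/
def pw {m : ℕ} (γ : Fin m → ℝ) (x : Fin m → ℝ) : ℝ := ∏ l, x l ^ γ l

/-- The product kernel `∏ K_{γ_l}(-c_l x_l t_l)`. -/
def kb {m : ℕ} (γ c x t : Fin m → ℝ) : ℝ := ∏ l, bk (γ l) (c l * x l * t l)

/-- The dilated Hankel–Clifford transform. -/
def HT {m : ℕ} (γ c : Fin m → ℝ) (F : (Fin m → ℝ) → ℂ) (t : Fin m → ℝ) : ℂ :=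
  ∫ x in Rpos m, ((pw γ x * kb γ c x t : ℝ) : ℂ) * F x

/-- The exponential `∏ exp(-r_l x_l)`. -/
def expf {m : ℕ} (r : Fin m → ℂ) (x : Fin m → ℝ) : ℂ := ∏ l, Complex.exp (-(r l * x l))

/-- An integrable majorant. -/
def dec {m : ℕ} (x : Fin m → ℝ) : ℝ := ∏ l, ((1 + x l) ^ 2)⁻¹

/-- Uniform bound for `kb`. -/
def kbd {m : ℕ} (γ : Fin m → ℝ) : ℝ := ∏ l, |bk (γ l) 0|

/-- Continuous functions on the orthant with rapid decay. -/
def RD {m : ℕ} (F : (Fin m → ℝ) → ℂ) : Prop :=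
  ContinuousOn F (Rpos m) ∧
    ∀ N : ℕ, ∃ C : ℝ, ∀ x ∈ Rpos m, (∏ i, (1 + x i) ^ N) * ‖F x‖ ≤ C

section basics
variable {m : ℕ} {γ c : Fin m → ℝ}

lemma pw_nonneg {x : Fin m → ℝ} (hx : ∀ i, 0 ≤ x i) : 0 ≤ pw γ x :=
  Finset.prod_nonneg fun l _ => Real.rpow_nonneg (hx l) _

lemma measurable_pw (γ : Fin m → ℝ) : Measurable (pw γ) :=
  Finset.measurable_prod _ fun l _ => (measurable_pi_apply l).pow_const (γ l)

lemma continuousOn_pw (γ : Fin m → ℝ) : ContinuousOn (pw γ) (Rpos m) := by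
  refine continuousOn_finsetProd _ fun l _ => ContinuousOn.rpow_const
    (continuous_apply l).continuousOn fun x hx => Or.inl (hx l).ne'

lemma kb_comm (x t : Fin m → ℝ) : kb γ c x t = kb γ c t x := by
  simp only [kb, mul_right_comm]

lemma continuous_kb_uncurry (hγ : ∀ l, 0 ≤ γ l) :
    Continuous fun p : (Fin m → ℝ) × (Fin m → ℝ) => kb γ c p.1 p.2 := by
  refine continuous_finsetProd _ fun l _ => (continuous_bk (hγ l)).comp ?_
  fun_prop

lemma continuous_kb_left (hγ : ∀ l, 0 ≤ γ l) (t : Fin m → ℝ) :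
    Continuous fun x => kb γ c x t :=
  (continuous_kb_uncurry hγ).comp (by fun_prop : Continuous fun x : Fin m → ℝ => (x, t))

lemma continuous_kb_right (hγ : ∀ l, 0 ≤ γ l) (x : Fin m → ℝ) :
    Continuous fun t => kb γ c x t :=
  (continuous_kb_uncurry hγ).comp (by fun_prop : Continuous fun t : Fin m → ℝ => (x, t))

lemma abs_kb_le (hγ : ∀ l, 0 ≤ γ l) (hc : ∀ l, 0 < c l) {x t : Fin m → ℝ}
    (hx : ∀ i, 0 ≤ x i) (ht : ∀ i, 0 ≤ t i) : |kb γ c x t| ≤ kbd γ := by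
  rw [kb, kbd, Finset.abs_prod]
  exact Finset.prod_le_prod (fun _ _ => abs_nonneg _) fun l _ =>
    abs_bk_le (hγ l) (mul_nonneg (mul_nonneg (hc l).le (hx l)) (ht l))

lemma kbd_nonneg (γ : Fin m → ℝ) : 0 ≤ kbd γ := Finset.prod_nonneg fun _ _ => abs_nonneg _

lemma dec_nonneg {x : Fin m → ℝ} : 0 ≤ dec x := Finset.prod_nonneg fun l _ => by positivity

lemma integrable_dec (m : ℕ) : IntegrableOn (dec (m := m)) (Rpos m) := by
  unfold IntegrableOn
  rw [restrict_Rpos]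
  refine Integrable.fintype_prod (f := fun _ x => ((1 + x) ^ 2)⁻¹) fun l => ?_
  have := integrableOn_add_rpow_Ioi_of_lt (a := -2) (c := 0) (m := 1) (by norm_num) (by norm_num)
  refine this.congr_fun (fun x hx => ?_) measurableSet_Ioi
  have hx : 0 < x := hx
  simp only
  rw [Real.rpow_neg (by positivity), add_comm]
  norm_num

lemma pw_mul_le {N : ℕ} (hγ : ∀ l, 0 ≤ γ l) (hN : ∀ l, γ l + 2 ≤ N) {x : Fin m → ℝ}
    (hx : ∀ i, 0 ≤ x i) : pw γ x ≤ (∏ i, (1 + x i) ^ N) * dec x := by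
  rw [pw, dec, ← Finset.prod_mul_distrib]
  refine Finset.prod_le_prod (fun l _ => Real.rpow_nonneg (hx l) _) fun l _ => ?_
  have h1 : 0 < 1 + x l := by linarith [hx l]
  rw [← div_eq_mul_inv, le_div_iff₀ (by positivity)]
  calc x l ^ γ l * (1 + x l) ^ 2 ≤ (1 + x l) ^ γ l * (1 + x l) ^ 2 := by
        gcongr
        · exact hx l
        · exact hγ l
        · linarith
    _ = (1 + x l) ^ (γ l + 2) := by
        rw [Real.rpow_add h1]; norm_num
    _ ≤ (1 + x l) ^ (N : ℝ) :=
        Real.rpow_le_rpow_of_exponent_le (by linarith [hx l]) (hN l)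
    _ = _ := Real.rpow_natCast _ _

lemma exists_nat_bound (γ : Fin m → ℝ) : ∃ N : ℕ, ∀ l, γ l + 2 ≤ N := by
  obtain ⟨N, hN⟩ := exists_nat_ge (∑ l, |γ l| + 2)
  refine ⟨N, fun l => le_trans ?_ hN⟩
  have := Finset.single_le_sum (f := fun l => |γ l|) (fun i _ => abs_nonneg _) (Finset.mem_univ l)
  have h2 := le_abs_self (γ l)
  linarith

lemma RD.exists_bound {F : (Fin m → ℝ) → ℂ} (hF : RD F) (hγ : ∀ l, 0 ≤ γ l) :
    ∃ C, ∀ x ∈ Rpos m, pw γ x * ‖F x‖ ≤ C * dec x := by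
  obtain ⟨N, hN⟩ := exists_nat_bound γ
  obtain ⟨C, hC⟩ := hF.2 N
  refine ⟨C, fun x hx => ?_⟩
  calc pw γ x * ‖F x‖ ≤ ((∏ i, (1 + x i) ^ N) * dec x) * ‖F x‖ := by
        gcongr; exact pw_mul_le hγ hN fun i => (hx i).le
    _ = ((∏ i, (1 + x i) ^ N) * ‖F x‖) * dec x := by ring
    _ ≤ _ := by gcongr; exacts [dec_nonneg, hC x hx]

lemma aesm_of_continuousOn {F : (Fin m → ℝ) → ℂ} (hF : ContinuousOn F (Rpos m)) :
    AEStronglyMeasurable F (volume.restrict (Rpos m)) :=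
  hF.aestronglyMeasurable (measurableSet_Rpos m)

lemma aesm_pw (γ : Fin m → ℝ) :
    AEStronglyMeasurable (fun x => ((pw γ x : ℝ) : ℂ)) (volume.restrict (Rpos m)) :=
  (Complex.measurable_ofReal.comp (measurable_pw γ)).aestronglyMeasurable

lemma RD.integrable {F : (Fin m → ℝ) → ℂ} (hF : RD F) (hγ : ∀ l, 0 ≤ γ l) :
    IntegrableOn (fun x => ((pw γ x : ℝ) : ℂ) * F x) (Rpos m) := by
  obtain ⟨C, hC⟩ := hF.exists_bound hγ
  refine Integrable.mono' ((integrable_dec m).const_mul C)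
    ((aesm_pw γ).mul (aesm_of_continuousOn hF.1)) ?_
  filter_upwards [ae_restrict_mem (measurableSet_Rpos m)] with x hx
  rw [norm_mul, Complex.norm_real, Real.norm_of_nonneg (pw_nonneg fun i => (hx i).le)]
  exact hC x hx

lemma aesm_kb (hγ : ∀ l, 0 ≤ γ l) (t : Fin m → ℝ) :
    AEStronglyMeasurable (fun x => ((kb γ c x t : ℝ) : ℂ)) (volume.restrict (Rpos m)) :=
  (Complex.continuous_ofReal.comp (continuous_kb_left hγ t)).aestronglyMeasurable

/-- The transform is symmetric with respect to the weight. -/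
lemma HT_symm (hγ : ∀ l, 0 ≤ γ l) (hc : ∀ l, 0 < c l) {F G : (Fin m → ℝ) → ℂ}
    (hF : IntegrableOn (fun x => ((pw γ x : ℝ) : ℂ) * F x) (Rpos m))
    (hG : IntegrableOn (fun x => ((pw γ x : ℝ) : ℂ) * G x) (Rpos m)) :
    ∫ t in Rpos m, (pw γ t : ℂ) * (HT γ c F t * G t)
      = ∫ x in Rpos m, (pw γ x : ℂ) * (F x * HT γ c G x) := by
  have hint : Integrable (Function.uncurry fun t x : Fin m → ℝ =>
      ((kb γ c t x : ℝ) : ℂ) * ((((pw γ t : ℝ) : ℂ) * G t) * (((pw γ x : ℝ) : ℂ) * F x)))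
      ((volume.restrict (Rpos m)).prod (volume.restrict (Rpos m))) := by
    refine Integrable.bdd_mul (c := kbd γ) (hG.mul_prod hF) ?_ ?_
    · exact (Complex.continuous_ofReal.comp (continuous_kb_uncurry hγ)).aestronglyMeasurable
    · rw [Measure.prod_restrict]
      filter_upwards [ae_restrict_mem ((measurableSet_Rpos m).prod (measurableSet_Rpos m))]
        with p hp
      rw [Complex.norm_real]
      exact abs_kb_le hγ hc (fun i => (hp.1 i).le) fun i => (hp.2 i).le
  have h := integral_integral_swap hint
  calc _ = ∫ t in Rpos m, ∫ x in Rpos m,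
        ((kb γ c t x : ℝ) : ℂ) * ((((pw γ t : ℝ) : ℂ) * G t) * (((pw γ x : ℝ) : ℂ) * F x)) := by
        refine integral_congr_ae (.of_forall fun t => ?_)
        simp only [HT]
        rw [mul_comm _ (G t), ← mul_assoc, ← integral_const_mul]
        refine integral_congr_ae (.of_forall fun x => ?_)
        simp only
        rw [kb_comm]
        push_cast
        ring
    _ = _ := by
        rw [h]
        refine integral_congr_ae (.of_forall fun x => ?_)
        simp only [HT]
        rw [← mul_assoc, ← integral_const_mul]
        refine integral_congr_ae (.of_forall fun t => ?_)
        simp only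
        push_cast
        ring

lemma continuous_expf (r : Fin m → ℂ) : Continuous (expf r) := by
  unfold expf
  fun_prop

lemma integrable_pw_expf (hγ : ∀ l, 0 ≤ γ l) {r : Fin m → ℂ} (hr : ∀ l, 0 < (r l).re) :
    IntegrableOn (fun x => ((pw γ x : ℝ) : ℂ) * expf r x) (Rpos m) := by
  unfold IntegrableOn
  rw [restrict_Rpos]
  have := Integrable.fintype_prod (μ := fun _ : Fin m => volume.restrict (Set.Ioi (0 : ℝ)))
    (f := fun l x => ((x ^ γ l : ℝ) : ℂ) * Complex.exp (-(r l * x)))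
    fun l => integrableOn_rpow_mul_cexp (hγ l) (hr l)
  refine this.congr (.of_forall fun x => ?_)
  simp only [pw, expf, Complex.ofReal_prod, Finset.prod_mul_distrib]

lemma HT_expf (hγ : ∀ l, 0 ≤ γ l) {r : Fin m → ℂ} (hr : ∀ l, 0 < (r l).re) (t : Fin m → ℝ) :
    HT γ c (expf r) t = (∏ l, r l ^ (-((γ l : ℂ) + 1))) * expf (fun l => c l / r l) t := by
  unfold HT
  rw [restrict_Rpos]
  have h := integral_fintype_prod_eq_prod (𝕜 := ℂ)
    (μ := fun _ : Fin m => volume.restrict (Set.Ioi (0 : ℝ)))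
    (fun l (x : ℝ) => ((x ^ γ l * bk (γ l) (c l * t l * x) : ℝ) : ℂ) * Complex.exp (-(r l * x)))
  simp_rw [fun l => integral_rpow_mul_bk_mul_cexp (s := c l * t l) (hγ l) (hr l)] at h
  rw [Finset.prod_mul_distrib] at h
  have e : expf (fun l => c l / r l) t
      = ∏ l, Complex.exp (-(((c l * t l : ℝ) : ℂ) / r l)) := by
    unfold expf
    refine Finset.prod_congr rfl fun l _ => ?_
    push_cast
    ring_nf
  rw [e, ← h]
  refine integral_congr_ae (.of_forall fun x => ?_)
  simp only [pw, kb, expf, ← Finset.prod_mul_distrib, Complex.ofReal_prod, mul_right_comm]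

lemma HT_const_mul (a : ℂ) (F : (Fin m → ℝ) → ℂ) (t : Fin m → ℝ) :
    HT γ c (fun x => a * F x) t = a * HT γ c F t := by
  simp only [HT, ← integral_const_mul]
  refine integral_congr_ae (.of_forall fun x => ?_)
  simp only
  ring

lemma HT_HT_expf (hγ : ∀ l, 0 ≤ γ l) (hc : ∀ l, 0 < c l) {r : Fin m → ℂ}
    (hr : ∀ l, 0 < (r l).re) (t : Fin m → ℝ) :
    HT γ c (HT γ c (expf r)) t = (∏ l, ((c l ^ (-(γ l + 1)) : ℝ) : ℂ)) * expf r t := by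
  have hr' : ∀ l, 0 < ((c l : ℂ) / r l).re := fun l => by
    rw [div_eq_mul_inv, Complex.re_ofReal_mul, Complex.inv_re]
    have h0 : r l ≠ 0 := by intro h; have := hr l; simp [h] at this
    exact mul_pos (hc l) (div_pos (hr l) (Complex.normSq_pos.2 h0))
  have h0 : ∀ l, r l ≠ 0 := fun l h => by have := hr l; simp [h] at this
  rw [show HT γ c (expf r) = fun t => (∏ l, r l ^ (-((γ l : ℂ) + 1))) *
    expf (fun l => c l / r l) t from funext fun t => HT_expf hγ hr t, HT_const_mul,
    HT_expf hγ hr', ← mul_assoc, ← Finset.prod_mul_distrib]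
  congr 1
  · exact Finset.prod_congr rfl fun l _ => inversion_constant (hc l) (hr l)
  · congr 1
    ext l
    have := Complex.ofReal_ne_zero.2 (hc l).ne'
    have := h0 l
    field_simp

/-- Uniqueness for multidimensional Laplace transforms of continuous functions. -/
lemma eq_zero_of_laplace_eq_zero {G : (Fin m → ℝ) → ℂ} (hG : ContinuousOn G (Rpos m))
    (hint : IntegrableOn (fun x => G x * expf (fun _ => 1) x) (Rpos m))
    (h0 : ∀ r : Fin m → ℂ, (∀ l, 0 < (r l).re) → ∫ x in Rpos m, G x * expf r x = 0)
    {x : Fin m → ℝ} (hx : x ∈ Rpos m) : G x = 0 := by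
  let g : (Fin m → ℝ) → ℂ := (Rpos m).indicator fun x => G x * expf (fun _ => 1) x
  let g' : EuclideanSpace ℝ (Fin m) → ℂ := fun v => g v.ofLp
  have hmp := PiLp.volume_preserving_ofLp (Fin m)
  have hemb : MeasurableEmbedding (@WithLp.ofLp 2 (Fin m → ℝ)) :=
    (MeasurableEquiv.toLp 2 (Fin m → ℝ)).symm.measurableEmbedding
  have hg : Integrable g := (integrable_indicator_iff (measurableSet_Rpos m)).2 hint
  have hg' : Integrable g' := (hmp.integrable_comp_emb hemb).2 hg
  have hF : FourierTransform.fourier g' = 0 := by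
    ext w
    rw [Real.fourier_eq']
    have h1 := hmp.integral_comp hemb (fun y : Fin m → ℝ =>
      Complex.exp ((↑(-2 * Real.pi * ∑ i, y i * w i) * Complex.I)) • g y)
    have h2 : ∀ v : EuclideanSpace ℝ (Fin m), inner ℝ v w = ∑ i, v i * w i := fun v => by
      simp [PiLp.inner_apply, mul_comm]
    simp_rw [h2]
    refine h1.trans ?_
    rw [show (0 : EuclideanSpace ℝ (Fin m) → ℂ) w = 0 from rfl,
      ← h0 (fun l => 1 + 2 * Real.pi * w l * Complex.I)
      (fun l => by simp), ← integral_indicator (measurableSet_Rpos m)]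
    refine integral_congr_ae (.of_forall fun y => ?_)
    by_cases hy : y ∈ Rpos m
    · simp only [g, Set.indicator_of_mem hy, expf, ← Complex.exp_sum, smul_eq_mul]
      rw [mul_left_comm, ← Complex.exp_add]
      congr 2
      push_cast
      rw [Finset.mul_sum, Finset.sum_mul, ← Finset.sum_add_distrib]
      refine Finset.sum_congr rfl fun i _ => ?_
      ring
    · simp [g, Set.indicator_of_notMem hy]
  have hcont : ContinuousAt g' (WithLp.toLp 2 x) := by
    have h1 : ContinuousAt g x := by
      have h2 : ContinuousAt (fun x => G x * expf (fun _ => 1) x) x :=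
        (hG.continuousAt ((isOpen_Rpos m).mem_nhds hx)).mul (continuous_expf _).continuousAt
      refine h2.congr ?_
      filter_upwards [(isOpen_Rpos m).mem_nhds hx] with y hy
      simp only [g, Set.indicator_of_mem hy]
    exact ContinuousAt.comp (f := fun v : EuclideanSpace ℝ (Fin m) => v.ofLp)
      (x := WithLp.toLp 2 x) h1 (PiLp.continuous_ofLp 2 _).continuousAt
  have h := hg'.fourierInv_fourier_eq (by rw [hF]; exact integrable_zero (EuclideanSpace ℝ (Fin m)) ℂ volume) hcont
  rw [hF] at h
  have h3 : g x = 0 := by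
    rw [show g x = g' (WithLp.toLp 2 x) from rfl, ← h]
    simp [Real.fourierInv_eq]
  rw [show g x = G x * expf (fun _ => 1) x from Set.indicator_of_mem hx _] at h3
  refine (mul_eq_zero.1 h3).resolve_right ?_
  exact Finset.prod_ne_zero_iff.2 fun l _ => Complex.exp_ne_zero _

end basics

/-- The closed orthant. -/
def Cpos (m : ℕ) : Set (Fin m → ℝ) := {x | ∀ i, 0 ≤ x i}

lemma Rpos_subset_Cpos (m : ℕ) : Rpos m ⊆ Cpos m := fun _ hx i => (hx i).le

section plancherel
variable {m : ℕ} {γ c : Fin m → ℝ}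

lemma norm_HT_le (hγ : ∀ l, 0 ≤ γ l) (hc : ∀ l, 0 < c l) {F : (Fin m → ℝ) → ℂ}
    (hF : IntegrableOn (fun x => ((pw γ x : ℝ) : ℂ) * F x) (Rpos m)) {t : Fin m → ℝ}
    (ht : t ∈ Cpos m) :
    ‖HT γ c F t‖ ≤ kbd γ * ∫ x in Rpos m, ‖((pw γ x : ℝ) : ℂ) * F x‖ := by
  rw [HT, ← integral_const_mul]
  refine norm_integral_le_of_norm_le (hF.norm.const_mul _) ?_
  filter_upwards [ae_restrict_mem (measurableSet_Rpos m)] with x hx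
  rw [Complex.ofReal_mul, mul_right_comm, norm_mul, mul_comm, Complex.norm_real]
  gcongr
  exact abs_kb_le hγ hc (fun i => (hx i).le) ht

lemma continuousOn_HT (hγ : ∀ l, 0 ≤ γ l) (hc : ∀ l, 0 < c l) {F : (Fin m → ℝ) → ℂ}
    (hF : IntegrableOn (fun x => ((pw γ x : ℝ) : ℂ) * F x) (Rpos m)) :
    ContinuousOn (HT γ c F) (Cpos m) := by
  have : ∀ t x, ((pw γ x * kb γ c x t : ℝ) : ℂ) * F x =
      ((kb γ c x t : ℝ) : ℂ) * (((pw γ x : ℝ) : ℂ) * F x) := fun t x => by push_cast; ring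
  unfold HT
  simp_rw [this]
  refine continuousOn_of_dominated (bound := fun x => kbd γ * ‖((pw γ x : ℝ) : ℂ) * F x‖)
    (fun t _ => (aesm_kb hγ t).mul hF.1) (fun t ht => ?_) (hF.norm.const_mul _) ?_
  · filter_upwards [ae_restrict_mem (measurableSet_Rpos m)] with x hx
    rw [norm_mul, Complex.norm_real]
    gcongr
    exact abs_kb_le hγ hc (fun i => (hx i).le) ht
  · refine .of_forall fun x => Continuous.continuousOn ?_
    exact (Complex.continuous_ofReal.comp (continuous_kb_right hγ x)).mul continuous_const

lemma RD.exists_norm_le {F : (Fin m → ℝ) → ℂ} (hF : RD F) : ∃ C, ∀ x ∈ Rpos m, ‖F x‖ ≤ C := by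
  obtain ⟨C, hC⟩ := hF.2 0
  exact ⟨C, fun x hx => by simpa using hC x hx⟩

/-- Inversion formula. -/
lemma HT_HT (hγ : ∀ l, 0 ≤ γ l) (hc : ∀ l, 0 < c l) {F : (Fin m → ℝ) → ℂ}
    (hF : RD F) (hH : RD (HT γ c F)) {x : Fin m → ℝ} (hx : x ∈ Rpos m) :
    HT γ c (HT γ c F) x = (∏ l, ((c l ^ (-(γ l + 1)) : ℝ) : ℂ)) * F x := by
  set κ : ℂ := ∏ l, ((c l ^ (-(γ l + 1)) : ℝ) : ℂ) with hκ
  have hFi := hF.integrable hγ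
  have hHi := hH.integrable hγ
  have hcont : ContinuousOn (HT γ c (HT γ c F)) (Rpos m) :=
    (continuousOn_HT hγ hc hHi).mono (Rpos_subset_Cpos m)
  have hexp : ∀ (A : (Fin m → ℝ) → ℂ), ContinuousOn A (Rpos m) →
      (∃ C, ∀ x ∈ Rpos m, ‖A x‖ ≤ C) → ∀ r : Fin m → ℂ, (∀ l, 0 < (r l).re) →
      IntegrableOn (fun x => ((pw γ x : ℝ) : ℂ) * (A x * expf r x)) (Rpos m) := by
    rintro A hA ⟨C, hC⟩ r hr
    have := (integrable_pw_expf hγ hr).bdd_mul (c := C) (f := A)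
      (aesm_of_continuousOn hA)
      ((ae_restrict_mem (measurableSet_Rpos m)).mono fun x hx => hC x hx)
    refine this.congr (.of_forall fun x => ?_)
    simp only
    ring
  have hb1 : ∃ C, ∀ x ∈ Rpos m, ‖HT γ c (HT γ c F) x‖ ≤ C :=
    ⟨_, fun x hx => norm_HT_le hγ hc hHi (Rpos_subset_Cpos m hx)⟩
  have key := eq_zero_of_laplace_eq_zero
    (G := fun x => ((pw γ x : ℝ) : ℂ) * (HT γ c (HT γ c F) x - κ * F x)) ?_ ?_ ?_ hx
  · have hp : ((pw γ x : ℝ) : ℂ) ≠ 0 := by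
      rw [Complex.ofReal_ne_zero]
      exact Finset.prod_ne_zero_iff.2 fun l _ => (Real.rpow_pos_of_pos (hx l) _).ne'
    exact sub_eq_zero.1 ((mul_eq_zero.1 key).resolve_left hp)
  · exact (Complex.continuous_ofReal.comp_continuousOn (continuousOn_pw γ)).mul
      (hcont.sub (continuousOn_const.mul hF.1))
  · have h1 := hexp _ hcont hb1 (fun _ => 1) (by simp)
    have h2 := hexp _ hF.1 hF.exists_norm_le (fun _ => 1) (by simp)
    refine (h1.sub (h2.const_mul κ)).congr (.of_forall fun y => ?_)
    simp only [Pi.sub_apply]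
    ring
  · intro r hr
    have h1 := hexp _ hcont hb1 r hr
    have h2 := hexp _ hF.1 hF.exists_norm_le r hr
    have hr' : ∀ l, 0 < ((c l : ℂ) / r l).re := fun l => by
      rw [div_eq_mul_inv, Complex.re_ofReal_mul, Complex.inv_re]
      have h0 : r l ≠ 0 := by intro h; have := hr l; simp [h] at this
      exact mul_pos (hc l) (div_pos (hr l) (Complex.normSq_pos.2 h0))
    have h3 : IntegrableOn (fun x => ((pw γ x : ℝ) : ℂ) * HT γ c (expf r) x) (Rpos m) := by
      refine ((integrable_pw_expf hγ hr').const_mul (∏ l, r l ^ (-((γ l : ℂ) + 1)))).congr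
        (.of_forall fun y => ?_)
      simp only [HT_expf hγ hr]
      ring
    have e1 := HT_symm hγ hc hHi (integrable_pw_expf hγ hr)
    have e2 := HT_symm hγ hc hFi h3
    simp only [HT_HT_expf hγ hc hr] at e2
    have e3 : ∫ x in Rpos m, (pw γ x : ℂ) * (HT γ c (HT γ c F) x * expf r x) =
        κ * ∫ x in Rpos m, (pw γ x : ℂ) * (F x * expf r x) := by
      rw [e1, e2, ← integral_const_mul]
      refine integral_congr_ae (.of_forall fun y => ?_)
      simp only
      ring
    have e4 := integral_sub h1 (h2.const_mul κ)
    rw [integral_const_mul, e3, sub_self] at e4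
    rw [← e4]
    refine integral_congr_ae (.of_forall fun y => ?_)
    simp only
    ring

lemma HT_conj (F : (Fin m → ℝ) → ℂ) (t : Fin m → ℝ) :
    HT γ c (fun x => (starRingEnd ℂ) (F x)) t = (starRingEnd ℂ) (HT γ c F t) := by
  rw [HT, HT, ← integral_conj]
  simp only [map_mul, Complex.conj_ofReal]

/-- Plancherel formula. -/
lemma HT_plancherel (hγ : ∀ l, 0 ≤ γ l) (hc : ∀ l, 0 < c l) {F : (Fin m → ℝ) → ℂ}
    (hF : RD F) (hH : RD (HT γ c F)) :
    ∫ t in Rpos m, pw γ t * ‖HT γ c F t‖ ^ 2 =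
      (∏ l, c l ^ (-(γ l + 1))) * ∫ x in Rpos m, pw γ x * ‖F x‖ ^ 2 := by
  have hconj : IntegrableOn (fun x => ((pw γ x : ℝ) : ℂ) * (starRingEnd ℂ) (HT γ c F x))
      (Rpos m) := by
    have h := hH.integrable hγ
    refine ⟨(aesm_pw γ).mul (Complex.continuous_conj.comp_aestronglyMeasurable
      (aesm_of_continuousOn hH.1)), ?_⟩
    refine h.2.congr' (.of_forall fun x => ?_)
    simp
  have e := HT_symm hγ hc (hF.integrable hγ) hconj
  rw [← Complex.ofReal_inj, Complex.ofReal_mul, ← integral_complex_ofReal,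
    ← integral_complex_ofReal, ← integral_const_mul]
  have e1 : ∀ x, ((pw γ x * ‖HT γ c F x‖ ^ 2 : ℝ) : ℂ) =
      (pw γ x : ℂ) * (HT γ c F x * (starRingEnd ℂ) (HT γ c F x)) := fun x => by
    rw [Complex.mul_conj']; push_cast; ring
  simp_rw [e1]
  rw [e]
  refine setIntegral_congr_fun (measurableSet_Rpos m) fun x hx => ?_
  rw [HT_conj, HT_HT hγ hc hF hH hx, map_mul, map_prod]
  simp only [Complex.conj_ofReal]
  have := Complex.mul_conj' (F x)
  push_cast at this ⊢
  rw [← this]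
  ring

end plancherel

/-- Boundary regularity and rapid decay of a function on the orthant. -/
def Good {d : ℕ} (g : (Fin d → ℝ) → ℂ) : Prop :=
  (∃ G : (Fin d → ℝ) → ℂ, ContinuousOn G (Cpos d) ∧ ∀ x ∈ Rpos d, G x = g x) ∧
  ∀ N : ℕ, ∃ C : ℝ, ∀ x ∈ Rpos d, (∏ i, (1 + x i) ^ N) * ‖g x‖ ≤ C

/-- Smoothness on the open orthant. -/
def Smooth {d : ℕ} (f : (Fin d → ℝ) → ℂ) : Prop := ContDiffOn ℝ (⊤ : ℕ∞) f (Rpos d)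

/-- Iterated partial derivatives along a word. -/
def pdw {d : ℕ} : List (Fin d) → ((Fin d → ℝ) → ℂ) → (Fin d → ℝ) → ℂ
  | [], f => f
  | j :: w, f => pdw w (pd j f)

/-- A word-indexed description of the space `S(ℝ^d₊)`. -/
def SS {d : ℕ} (f : (Fin d → ℝ) → ℂ) : Prop := Smooth f ∧ ∀ w, Good (pdw w f)

section classS
variable {d : ℕ} {f g : (Fin d → ℝ) → ℂ}

lemma Good.congr (hf : Good f) (h : Set.EqOn f g (Rpos d)) : Good g := by
  obtain ⟨⟨G, hG, hGf⟩, hb⟩ := hf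
  refine ⟨⟨G, hG, fun x hx => (hGf x hx).trans (h hx)⟩, fun N => ?_⟩
  obtain ⟨C, hC⟩ := hb N
  exact ⟨C, fun x hx => h hx ▸ hC x hx⟩

lemma prod_one_add_pos {x : Fin d → ℝ} (hx : x ∈ Rpos d) (N : ℕ) : 0 < ∏ i, (1 + x i) ^ N :=
  Finset.prod_pos fun i _ => pow_pos (by linarith [hx i]) N

lemma Good.add (hf : Good f) (hg : Good g) : Good (fun x => f x + g x) := by
  obtain ⟨⟨F, hF, hFf⟩, hb⟩ := hf
  obtain ⟨⟨G, hG, hGg⟩, hb'⟩ := hg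
  refine ⟨⟨fun x => F x + G x, hF.add hG, fun x hx => by simp only [hFf x hx, hGg x hx]⟩,
    fun N => ?_⟩
  obtain ⟨C, hC⟩ := hb N
  obtain ⟨C', hC'⟩ := hb' N
  refine ⟨C + C', fun x hx => ?_⟩
  calc _ ≤ (∏ i, (1 + x i) ^ N) * (‖f x‖ + ‖g x‖) := by
        gcongr
        · exact (prod_one_add_pos hx N).le
        · exact norm_add_le _ _
    _ ≤ _ := by rw [mul_add]; exact add_le_add (hC x hx) (hC' x hx)

lemma Good.const_mul (hf : Good f) (a : ℂ) : Good (fun x => a * f x) := by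
  obtain ⟨⟨F, hF, hFf⟩, hb⟩ := hf
  refine ⟨⟨fun x => a * F x, continuousOn_const.mul hF, fun x hx => by simp only [hFf x hx]⟩,
    fun N => ?_⟩
  obtain ⟨C, hC⟩ := hb N
  refine ⟨‖a‖ * C, fun x hx => ?_⟩
  rw [norm_mul, mul_left_comm]
  exact mul_le_mul_of_nonneg_left (hC x hx) (norm_nonneg _)

lemma Good.coord_mul (hf : Good f) (i : Fin d) : Good (fun x => (x i : ℂ) * f x) := by
  obtain ⟨⟨F, hF, hFf⟩, hb⟩ := hf
  refine ⟨⟨fun x => (x i : ℂ) * F x, ContinuousOn.mul (by fun_prop) hF,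
    fun x hx => by simp only [hFf x hx]⟩, fun N => ?_⟩
  obtain ⟨C, hC⟩ := hb (N + 1)
  refine ⟨C, fun x hx => le_trans ?_ (hC x hx)⟩
  have h1 : ∀ j, 1 ≤ 1 + x j := fun j => by linarith [hx j]
  have h2 : x i ≤ ∏ j, (1 + x j) := by
    calc x i ≤ 1 + x i := by linarith
      _ ≤ _ := by
        rw [← Finset.mul_prod_erase _ _ (Finset.mem_univ i)]
        refine le_mul_of_one_le_right (by linarith [h1 i]) ?_
        exact Finset.one_le_prod fun j _ => h1 j
  have h3 : (∏ j, (1 + x j) ^ (N + 1)) = (∏ j, (1 + x j) ^ N) * ∏ j, (1 + x j) := by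
    rw [← Finset.prod_mul_distrib]; exact Finset.prod_congr rfl fun j _ => pow_succ _ _
  rw [norm_mul, Complex.norm_real, Real.norm_of_nonneg (hx i).le, h3, ← mul_assoc]
  have := (prod_one_add_pos hx N).le
  gcongr

lemma contDiffAt (hf : Smooth f) {x : Fin d → ℝ} (hx : x ∈ Rpos d) :
    ContDiffAt ℝ (⊤ : ℕ∞) f x :=
  ContDiffOn.contDiffAt hf ((isOpen_Rpos d).mem_nhds hx)

lemma Smooth.differentiableAt (hf : Smooth f) {x : Fin d → ℝ} (hx : x ∈ Rpos d) :
    DifferentiableAt ℝ f x := (contDiffAt hf hx).differentiableAt (by simp)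

lemma Smooth.pd (hf : Smooth f) (j : Fin d) : Smooth (pd j f) := by
  have := ((contDiffOn_infty_iff_fderiv_of_isOpen (isOpen_Rpos d)).1 hf).2
  exact this.clm_apply contDiffOn_const

lemma Smooth.congr (hf : Smooth f) (h : Set.EqOn f g (Rpos d)) : Smooth g :=
  ContDiffOn.congr hf fun _ hx => (h hx).symm

lemma pd_congr (h : Set.EqOn f g (Rpos d)) (j : Fin d) : Set.EqOn (pd j f) (pd j g) (Rpos d) := by
  intro x hx
  have : f =ᶠ[nhds x] g := h.eventuallyEq_of_mem ((isOpen_Rpos d).mem_nhds hx)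
  simp only [pd, this.fderiv_eq]

lemma pdw_congr (w : List (Fin d)) : ∀ {f g : (Fin d → ℝ) → ℂ}, Set.EqOn f g (Rpos d) →
    Set.EqOn (pdw w f) (pdw w g) (Rpos d) := by
  induction w with
  | nil => exact fun h => h
  | cons j w ih => exact fun h => ih (pd_congr h j)

lemma pd_comm (hf : Smooth f) (i j : Fin d) :
    Set.EqOn (pd i (pd j f)) (pd j (pd i f)) (Rpos d) := by
  intro x hx
  have hd : DifferentiableAt ℝ (fderiv ℝ f) x :=
    ((contDiffAt hf hx).fderiv_right (m := 1)
      (WithTop.coe_le_coe.2 (le_top : (2 : ℕ∞) ≤ ⊤))).differentiableAt (by simp)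
  have e : ∀ a b : Fin d, pd a (pd b f) x =
      fderiv ℝ (fderiv ℝ f) x (Pi.single a 1) (Pi.single b 1) := fun a b => by
    unfold pd
    rw [fderiv_clm_apply hd (differentiableAt_const _)]
    simp
  rw [e, e]
  exact ((contDiffAt hf hx).isSymmSndFDerivAt
    (by simp only [minSmoothness_of_isRCLikeNormedField]; exact WithTop.coe_le_coe.2 (le_top : (2 : ℕ∞) ≤ ⊤))) _ _

lemma pd_add (hf : Smooth f) (hg : Smooth g) (j : Fin d) :
    Set.EqOn (pd j fun x => f x + g x) (fun x => pd j f x + pd j g x) (Rpos d) := by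
  intro x hx
  simp only [pd]
  rw [fderiv_fun_add (hf.differentiableAt hx) (hg.differentiableAt hx)]
  rfl

lemma pd_const_mul (hf : Smooth f) (a : ℂ) (j : Fin d) :
    Set.EqOn (pd j fun x => a * f x) (fun x => a * pd j f x) (Rpos d) := by
  intro x hx
  simp only [pd]
  rw [fderiv_const_mul (hf.differentiableAt hx)]
  rfl

lemma pd_coord_mul (hf : Smooth f) (i j : Fin d) :
    Set.EqOn (pd j fun x => (x i : ℂ) * f x)
      (fun x => (x i : ℂ) * pd j f x + (if i = j then 1 else 0) * f x) (Rpos d) := by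
  intro x hx
  simp only [pd]
  have h1 : HasFDerivAt (fun x : Fin d → ℝ => (x i : ℂ))
      (Complex.ofRealCLM.comp (ContinuousLinearMap.proj i)) x :=
    (Complex.ofRealCLM.comp (ContinuousLinearMap.proj (R := ℝ) (φ := fun _ : Fin d => ℝ) i)).hasFDerivAt
  rw [HasFDerivAt.fderiv (f := fun x : Fin d → ℝ => (x i : ℂ) * f x)
    (h1.mul (hf.differentiableAt hx).hasFDerivAt)]
  by_cases h : i = j
  · subst h; simp
  · simp [h]

lemma SS.smooth (hf : SS f) : Smooth f := hf.1
lemma SS.good (hf : SS f) : Good f := hf.2 []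
lemma SS.pd (hf : SS f) (j : Fin d) : SS (pd j f) := ⟨hf.1.pd j, fun w => hf.2 (j :: w)⟩
lemma SS.congr (hf : SS f) (h : Set.EqOn f g (Rpos d)) : SS g :=
  ⟨hf.1.congr h, fun w => (hf.2 w).congr (pdw_congr w h)⟩

/-- Coinduction principle for `SS`. -/
lemma SS.of_invariant (A : Set ((Fin d → ℝ) → ℂ)) (h1 : ∀ f ∈ A, Smooth f)
    (h2 : ∀ f ∈ A, Good f) (h3 : ∀ f ∈ A, ∀ j, ∃ g ∈ A, Set.EqOn g (_root_.pd j f) (Rpos d)) :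
    ∀ f ∈ A, SS f := by
  refine fun f hf => ⟨h1 f hf, fun w => ?_⟩
  induction w generalizing f with
  | nil => exact h2 f hf
  | cons j w ih =>
    obtain ⟨g, hg, hgf⟩ := h3 f hf j
    exact (ih g hg).congr (pdw_congr w hgf)

lemma Smooth.add (hf : Smooth f) (hg : Smooth g) : Smooth (fun x => f x + g x) :=
  ContDiffOn.add hf hg
lemma Smooth.const_mul (hf : Smooth f) (a : ℂ) : Smooth (fun x => a * f x) :=
  ContDiffOn.mul contDiffOn_const hf
lemma Smooth.coord_mul (hf : Smooth f) (i : Fin d) : Smooth (fun x => (x i : ℂ) * f x) := by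
  refine ContDiffOn.mul (ContDiff.contDiffOn ?_) hf
  exact Complex.ofRealCLM.contDiff.comp (contDiff_apply ℝ ℝ i)

lemma SS.add (hf : SS f) (hg : SS g) : SS (fun x => f x + g x) := by
  refine SS.of_invariant {u | ∃ f g, SS f ∧ SS g ∧ u = fun x => f x + g x} ?_ ?_ ?_ _
    ⟨f, g, hf, hg, rfl⟩
  · rintro _ ⟨f, g, hf, hg, rfl⟩; exact hf.1.add hg.1
  · rintro _ ⟨f, g, hf, hg, rfl⟩; exact hf.good.add hg.good
  · rintro _ ⟨f, g, hf, hg, rfl⟩ j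
    exact ⟨_, ⟨_, _, hf.pd j, hg.pd j, rfl⟩, (pd_add hf.1 hg.1 j).symm⟩

lemma SS.const_mul (hf : SS f) (a : ℂ) : SS (fun x => a * f x) := by
  refine SS.of_invariant {u | ∃ f, SS f ∧ u = fun x => a * f x} ?_ ?_ ?_ _
    ⟨f, hf, rfl⟩
  · rintro _ ⟨f, hf, rfl⟩; exact hf.1.const_mul a
  · rintro _ ⟨f, hf, rfl⟩; exact hf.good.const_mul a
  · rintro _ ⟨f, hf, rfl⟩ j
    exact ⟨_, ⟨_, hf.pd j, rfl⟩, (pd_const_mul hf.1 a j).symm⟩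

lemma SS.coord_mul (hf : SS f) (i : Fin d) : SS (fun x => (x i : ℂ) * f x) := by
  refine SS.congr (f := fun x => (x i : ℂ) * f x + 0 * f x) ?_ (fun x _ => by simp)
  refine SS.of_invariant {u | ∃ f g, SS f ∧ SS g ∧ u = fun x => (x i : ℂ) * f x + g x} ?_ ?_ ?_ _
    ⟨f, _, hf, hf.const_mul 0, rfl⟩
  · rintro _ ⟨f, g, hf, hg, rfl⟩; exact (hf.1.coord_mul i).add hg.1
  · rintro _ ⟨f, g, hf, hg, rfl⟩; exact (hf.good.coord_mul i).add hg.good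
  · rintro _ ⟨f, g, hf, hg, rfl⟩ j
    refine ⟨_, ⟨_, _, hf.pd j, (hf.const_mul (if i = j then 1 else 0)).add (hg.pd j), rfl⟩,
      fun x hx => ?_⟩
    rw [pd_add (hf.1.coord_mul i) hg.1 j hx]
    simp only [pd_coord_mul hf.1 i j hx]
    ring

/-- Mixed derivative along a list of coordinates. -/
def lderiv (p : Fin d → ℕ) : List (Fin d) → ((Fin d → ℝ) → ℂ) → (Fin d → ℝ) → ℂ
  | [], f => f
  | i :: L, f => (pd i)^[p i] (lderiv p L f)

lemma mderiv_eq_lderiv (p : Fin d → ℕ) (f : (Fin d → ℝ) → ℂ) :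
    mderiv p f = lderiv p (List.finRange d) f := by
  rw [mderiv, List.ofFn_eq_map]
  induction List.finRange d with
  | nil => rfl
  | cons i L ih => simp only [List.map_cons, List.foldr_cons, Function.comp_apply, lderiv, ← ih]

lemma Smooth.iterate (hf : Smooth f) (j : Fin d) (n : ℕ) : Smooth ((_root_.pd j)^[n] f) := by
  induction n with
  | zero => exact hf
  | succ n ih => rw [Function.iterate_succ_apply']; exact ih.pd j

lemma SS.iterate (hf : SS f) (j : Fin d) (n : ℕ) : SS ((_root_.pd j)^[n] f) := by
  induction n with
  | zero => exact hf
  | succ n ih => rw [Function.iterate_succ_apply']; exact ih.pd j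

lemma Smooth.lderiv (hf : Smooth f) (p : Fin d → ℕ) (L : List (Fin d)) :
    Smooth (lderiv p L f) := by
  induction L with
  | nil => exact hf
  | cons i L ih => exact ih.iterate i _

lemma SS.lderiv (hf : SS f) (p : Fin d → ℕ) (L : List (Fin d)) : SS (lderiv p L f) := by
  induction L with
  | nil => exact hf
  | cons i L ih => exact ih.iterate i _

lemma iterate_congr (h : Set.EqOn f g (Rpos d)) (j : Fin d) (n : ℕ) :
    Set.EqOn ((pd j)^[n] f) ((pd j)^[n] g) (Rpos d) := by
  induction n with
  | zero => exact h
  | succ n ih => simp only [Function.iterate_succ_apply']; exact pd_congr ih j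

lemma pd_iterate_comm (hf : Smooth f) (i j : Fin d) (n : ℕ) :
    Set.EqOn (pd j ((pd i)^[n] f)) ((pd i)^[n] (pd j f)) (Rpos d) := by
  induction n with
  | zero => exact fun _ _ => rfl
  | succ n ih =>
    simp only [Function.iterate_succ_apply']
    exact (pd_comm (hf.iterate i n) j i).trans (pd_congr ih i)

lemma lderiv_congr_index {p q : Fin d → ℕ} {L : List (Fin d)} (h : ∀ i ∈ L, p i = q i) :
    lderiv p L f = lderiv q L f := by
  induction L with
  | nil => rfl
  | cons i L ih =>
    simp only [lderiv, h i (by simp), ih fun k hk => h k (by simp [hk])]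

lemma pd_lderiv (hf : Smooth f) (p : Fin d → ℕ) (j : Fin d) {L : List (Fin d)} (hL : L.Nodup)
    (hj : j ∈ L) :
    Set.EqOn (pd j (lderiv p L f)) (lderiv (p + Pi.single j 1) L f) (Rpos d) := by
  induction L with
  | nil => simp at hj
  | cons i L ih =>
    rw [List.nodup_cons] at hL
    by_cases h : i = j
    · subst h
      simp only [lderiv, Pi.add_apply, Pi.single_eq_same, Function.iterate_succ_apply']
      rw [lderiv_congr_index (p := p) (q := p + Pi.single i 1) fun k hk => ?_]
      · exact fun _ _ => rfl
      · have : k ≠ i := fun h => hL.1 (h ▸ hk)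
        simp [this]
    · have hj' : j ∈ L := by
        rcases List.mem_cons.1 hj with h' | h'
        · exact absurd h'.symm h
        · exact h'
      simp only [lderiv, Pi.add_apply, Pi.single_eq_of_ne h, add_zero]
      exact (pd_iterate_comm (hf.lderiv p L) i j (p i)).trans (iterate_congr (ih hL.2 hj') i _)

lemma pd_mderiv (hf : Smooth f) (p : Fin d → ℕ) (j : Fin d) :
    Set.EqOn (pd j (mderiv p f)) (mderiv (p + Pi.single j 1) f) (Rpos d) := by
  simp only [mderiv_eq_lderiv]
  exact pd_lderiv hf p j (List.nodup_finRange d) (List.mem_finRange j)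

lemma mderiv_zero (f : (Fin d → ℝ) → ℂ) : mderiv 0 f = f := by
  rw [mderiv_eq_lderiv]
  induction List.finRange d with
  | nil => rfl
  | cons i L ih => simp [lderiv, ih]

lemma SS.mderiv (hf : SS f) (p : Fin d → ℕ) : SS (mderiv p f) := by
  rw [mderiv_eq_lderiv]; exact hf.lderiv p _

lemma Smooth.mderiv (hf : Smooth f) (p : Fin d → ℕ) : Smooth (mderiv p f) := by
  rw [mderiv_eq_lderiv]; exact hf.lderiv p _

lemma SS.isSPlus (hf : SS f) : IsSPlus f := by
  refine ⟨hf.1, fun p => (hf.mderiv p).good.1, fun k p => ?_⟩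
  obtain ⟨C, hC⟩ := (hf.mderiv p).good.2 (∑ i, k i)
  refine ⟨C, fun x hx => le_trans ?_ (hC x hx)⟩
  gcongr with i
  · exact fun i _ => pow_nonneg (hx i).le _
  · calc x i ^ k i ≤ (1 + x i) ^ k i := by
          have := hx i
          gcongr
          linarith
      _ ≤ _ := pow_le_pow_right₀ (by linarith [hx i])
          (Finset.single_le_sum (fun _ _ => Nat.zero_le _) (Finset.mem_univ i))

lemma exists_decay_bound {x : Fin d → ℝ} (hx : x ∈ Rpos d) (N : ℕ) :
    ∏ i, (1 + x i) ^ N ≤ (2 ^ (N - 1)) ^ d *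
      ∑ s : Finset (Fin d), ∏ i, x i ^ (if i ∈ s then N else 0) := by
  calc ∏ i, (1 + x i) ^ N ≤ ∏ i, (2 ^ (N - 1) * (1 + x i ^ N)) := by
        refine Finset.prod_le_prod (fun i _ => pow_nonneg (by linarith [hx i]) _) fun i _ => ?_
        simpa using add_pow_le zero_le_one (hx i).le N
    _ = _ := by
        rw [Finset.prod_mul_distrib, Finset.prod_const, Finset.card_univ, Fintype.card_fin,
          Finset.prod_one_add, ← Finset.powerset_univ]
        congr 1
        refine Finset.sum_congr rfl fun s _ => ?_
        rw [← Finset.prod_subset (Finset.subset_univ s)]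
        · exact Finset.prod_congr rfl fun i hi => by simp [hi]
        · intro i _ hi; simp [hi]

lemma IsSPlus.ss (hf : IsSPlus f) : SS f := by
  have hs : Smooth f := hf.1
  rw [← mderiv_zero f]
  refine SS.of_invariant (Set.range fun p => _root_.mderiv p f) ?_ ?_ ?_ _ ⟨0, rfl⟩
  · rintro _ ⟨p, rfl⟩; exact hs.mderiv p
  · rintro _ ⟨p, rfl⟩
    refine ⟨hf.2.1 p, fun N => ?_⟩
    choose C hC using fun s : Finset (Fin d) => hf.2.2 (fun i => if i ∈ s then N else 0) p
    refine ⟨(2 ^ (N - 1)) ^ d * ∑ s, C s, fun x hx => ?_⟩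
    calc _ ≤ ((2 ^ (N - 1)) ^ d * ∑ s : Finset (Fin d), ∏ i, x i ^ (if i ∈ s then N else 0)) *
          ‖_root_.mderiv p f x‖ := by gcongr; exact exists_decay_bound hx N
      _ = (2 ^ (N - 1)) ^ d * ∑ s : Finset (Fin d),
          (∏ i, x i ^ (if i ∈ s then N else 0)) * ‖_root_.mderiv p f x‖ := by
        rw [mul_assoc, Finset.sum_mul]
      _ ≤ _ := by gcongr with s; exact hC s x hx
  · rintro _ ⟨p, rfl⟩ j
    exact ⟨_, ⟨p + Pi.single j 1, rfl⟩, (pd_mderiv hs p j).symm⟩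

/-- Induction on multi-indices by unit increments. -/
lemma multiindex_induction {n : ℕ} {P : (Fin n → ℕ) → Prop} (h0 : P 0)
    (hs : ∀ p j, P p → P (p + Pi.single j 1)) (p : Fin n → ℕ) : P p := by
  induction hN : ∑ i, p i generalizing p with
  | zero =>
    have : p = 0 := funext fun i => (Finset.sum_eq_zero_iff.1 hN) i (Finset.mem_univ i)
    exact this ▸ h0
  | succ N ih =>
    obtain ⟨j, -, hj⟩ := Finset.exists_ne_zero_of_sum_ne_zero (s := Finset.univ) (f := p) (by omega)
    have hp : p = Function.update p j (p j - 1) + Pi.single j 1 := by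
      ext i
      by_cases h : i = j
      · subst h; simp; omega
      · simp [h]
    rw [hp]
    refine hs _ j (ih _ ?_)
    rw [hp] at hN
    simp only [Pi.add_apply, Finset.sum_add_distrib, Finset.sum_pi_single', Finset.mem_univ,
      if_true] at hN
    omega

end classS

section slices
variable {d' d'' : ℕ}

/-- The first block of coordinates. -/
def tl (t : Fin (d' + d'') → ℝ) : Fin d' → ℝ := fun l => t (Fin.castAdd d'' l)

/-- The second block of coordinates. -/
def tr (t : Fin (d' + d'') → ℝ) : Fin d'' → ℝ := fun j => t (Fin.natAdd d' j)

/-- The partial transform in the first block of coordinates. -/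
def HP (γ c : Fin d' → ℝ) (f : (Fin (d' + d'') → ℝ) → ℂ) (t : Fin (d' + d'') → ℝ) : ℂ :=
  HT γ c (fun x => f (Fin.append x (tr t))) (tl t)

lemma append_mem_Rpos {x : Fin d' → ℝ} {y : Fin d'' → ℝ} (hx : x ∈ Rpos d') (hy : y ∈ Rpos d'') :
    Fin.append x y ∈ Rpos (d' + d'') := by
  intro i
  refine Fin.addCases (fun l => ?_) (fun l => ?_) i
  · simpa using hx l
  · simpa using hy l

lemma append_mem_Cpos {x : Fin d' → ℝ} {y : Fin d'' → ℝ} (hx : x ∈ Cpos d') (hy : y ∈ Cpos d'') :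
    Fin.append x y ∈ Cpos (d' + d'') := by
  intro i
  refine Fin.addCases (fun l => ?_) (fun l => ?_) i
  · simpa using hx l
  · simpa using hy l

lemma tl_mem_Rpos {t : Fin (d' + d'') → ℝ} (ht : t ∈ Rpos (d' + d'')) : tl t ∈ Rpos d' :=
  fun _ => ht _

lemma tr_mem_Rpos {t : Fin (d' + d'') → ℝ} (ht : t ∈ Rpos (d' + d'')) : tr t ∈ Rpos d'' :=
  fun _ => ht _

lemma tl_mem_Cpos {t : Fin (d' + d'') → ℝ} (ht : t ∈ Cpos (d' + d'')) : tl t ∈ Cpos d' :=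
  fun _ => ht _

lemma tr_mem_Cpos {t : Fin (d' + d'') → ℝ} (ht : t ∈ Cpos (d' + d'')) : tr t ∈ Cpos d'' :=
  fun _ => ht _

lemma tl_append (x : Fin d' → ℝ) (y : Fin d'' → ℝ) : tl (Fin.append x y) = x := by
  ext l; simp [tl]

lemma tr_append (x : Fin d' → ℝ) (y : Fin d'' → ℝ) : tr (Fin.append x y) = y := by
  ext l; simp [tr]

lemma continuous_tl : Continuous (tl (d' := d') (d'' := d'')) := by unfold tl; fun_prop

lemma continuous_tr : Continuous (tr (d' := d') (d'' := d'')) := by unfold tr; fun_prop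

lemma continuous_append :
    Continuous fun p : (Fin d' → ℝ) × (Fin d'' → ℝ) => Fin.append p.1 p.2 := by
  refine continuous_pi fun i => ?_
  refine Fin.addCases (fun l => ?_) (fun l => ?_) i
  · simp only [Fin.append_left]; fun_prop
  · simp only [Fin.append_right]; fun_prop

lemma closure_Rpos (m : ℕ) : closure (Rpos m) = Cpos m := by
  rw [Rpos_eq_pi, closure_pi_set]
  ext x
  simp [Cpos, Pi.le_def]

variable {γ c : Fin d' → ℝ} {f : (Fin (d' + d'') → ℝ) → ℂ}

lemma continuousOn_slice {s : Set (Fin (d' + d'') → ℝ)} {u : Set (Fin d' → ℝ)}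
    (hf : ContinuousOn f s) {y : Fin d'' → ℝ} (h : ∀ x ∈ u, Fin.append x y ∈ s) :
    ContinuousOn (fun x => f (Fin.append x y)) u :=
  hf.comp (continuous_append.comp (by fun_prop : Continuous fun x : Fin d' → ℝ =>
    (x, y))).continuousOn h

lemma prod_append (N : ℕ) (x : Fin d' → ℝ) (y : Fin d'' → ℝ) :
    ∏ i, (1 + Fin.append x y i) ^ N = (∏ i, (1 + x i) ^ N) * ∏ i, (1 + y i) ^ N := by
  rw [Fin.prod_univ_add]; simp

lemma one_le_prod_one_add {m : ℕ} {x : Fin m → ℝ} (hx : x ∈ Cpos m) (N : ℕ) :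
    1 ≤ ∏ i, (1 + x i) ^ N :=
  Finset.one_le_prod fun i _ => one_le_pow₀ (by linarith [hx i])

lemma Good.continuousOn_Rpos {m : ℕ} {f : (Fin m → ℝ) → ℂ} (hf : Good f) :
    ContinuousOn f (Rpos m) := by
  obtain ⟨⟨G, hG, h⟩, -⟩ := hf
  exact (hG.mono (Rpos_subset_Cpos m)).congr fun x hx => (h x hx).symm

lemma Good.slice (hf : Good f) {y : Fin d'' → ℝ} (hy : y ∈ Rpos d'') :
    RD (fun x : Fin d' → ℝ => f (Fin.append x y)) := by
  refine ⟨continuousOn_slice hf.continuousOn_Rpos fun x hx => append_mem_Rpos hx hy, fun N => ?_⟩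
  obtain ⟨C, hC⟩ := hf.2 N
  refine ⟨C, fun x hx => le_trans ?_ (hC _ (append_mem_Rpos hx hy))⟩
  rw [prod_append]
  have h1 := (prod_one_add_pos hx N).le
  exact mul_le_mul_of_nonneg_right
    (le_mul_of_one_le_right h1 (one_le_prod_one_add (Rpos_subset_Cpos _ hy) N)) (norm_nonneg _)

lemma Good.exists_majorant (hf : Good f) (hγ : ∀ l, 0 ≤ γ l) (N : ℕ) :
    ∃ C, 0 ≤ C ∧ ∀ x ∈ Rpos d', ∀ y ∈ Rpos d'',
      (∏ i, (1 + y i) ^ N) * (pw γ x * ‖f (Fin.append x y)‖) ≤ C * dec x := by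
  obtain ⟨N₁, hN₁⟩ := exists_nat_bound γ
  obtain ⟨C, hC⟩ := hf.2 (max N N₁)
  refine ⟨max C 0, le_max_right _ _, fun x hx y hy => ?_⟩
  have e := hC _ (append_mem_Rpos hx hy)
  rw [prod_append] at e
  have hy1 : (∏ i, (1 + y i) ^ N) ≤ ∏ i, (1 + y i) ^ (max N N₁) :=
    Finset.prod_le_prod (fun i _ => pow_nonneg (by linarith [hy i]) _) fun i _ =>
      pow_le_pow_right₀ (by linarith [hy i]) (le_max_left _ _)
  have hx1 : pw γ x ≤ (∏ i, (1 + x i) ^ (max N N₁)) * dec x :=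
    pw_mul_le hγ (fun l => (hN₁ l).trans (by exact_mod_cast le_max_right _ _)) fun i => (hx i).le
  have p1 := (prod_one_add_pos hy (max N N₁)).le
  have p2 := (prod_one_add_pos hx (max N N₁)).le
  have p3 : 0 ≤ pw γ x := pw_nonneg fun i => (hx i).le
  have p4 := dec_nonneg (x := x)
  calc _ ≤ (∏ i, (1 + y i) ^ (max N N₁)) * (((∏ i, (1 + x i) ^ (max N N₁)) * dec x) *
        ‖f (Fin.append x y)‖) := by gcongr
    _ = ((∏ i, (1 + x i) ^ (max N N₁)) * (∏ i, (1 + y i) ^ (max N N₁)) *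
        ‖f (Fin.append x y)‖) * dec x := by ring
    _ ≤ C * dec x := by gcongr
    _ ≤ _ := by gcongr; exact le_max_left _ _

lemma Good.exists_majorant' (hf : Good f) (hγ : ∀ l, 0 ≤ γ l) :
    ∃ C, 0 ≤ C ∧ ∀ x ∈ Rpos d', ∀ y ∈ Rpos d'', pw γ x * ‖f (Fin.append x y)‖ ≤ C * dec x := by
  obtain ⟨C, hC, h⟩ := hf.exists_majorant hγ 0
  exact ⟨C, hC, fun x hx y hy => by simpa using h x hx y hy⟩

lemma Good.exists_norm_HP_le (hf : Good f) (hγ : ∀ l, 0 ≤ γ l) (hc : ∀ l, 0 < c l) :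
    ∃ C, ∀ t ∈ Rpos (d' + d''), ‖HP γ c f t‖ ≤ C := by
  obtain ⟨C, hC0, hC⟩ := hf.exists_majorant' hγ
  refine ⟨kbd γ * ∫ x in Rpos d', C * dec x, fun t ht => ?_⟩
  have h1 := (hf.slice (tr_mem_Rpos ht)).integrable hγ
  refine (norm_HT_le hγ hc h1 (tl_mem_Cpos (Rpos_subset_Cpos _ ht))).trans ?_
  refine mul_le_mul_of_nonneg_left ?_ (kbd_nonneg γ)
  refine setIntegral_mono_on h1.norm ((integrable_dec d').const_mul C) (measurableSet_Rpos d')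
    fun x hx => ?_
  rw [norm_mul, Complex.norm_real, Real.norm_of_nonneg (pw_nonneg fun i => (hx i).le)]
  exact hC x hx _ (tr_mem_Rpos ht)

lemma HP_congr {g : (Fin (d' + d'') → ℝ) → ℂ} (h : Set.EqOn f g (Rpos (d' + d''))) :
    Set.EqOn (HP γ c f) (HP γ c g) (Rpos (d' + d'')) := by
  intro t ht
  refine setIntegral_congr_fun (measurableSet_Rpos d') fun x hx => ?_
  simp only
  rw [h (append_mem_Rpos hx (tr_mem_Rpos ht))]

lemma HP_const_mul (a : ℂ) (t : Fin (d' + d'') → ℝ) :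
    HP γ c (fun x => a * f x) t = a * HP γ c f t := HT_const_mul a _ _

lemma integrable_kernel (hγ : ∀ l, 0 ≤ γ l) (hc : ∀ l, 0 < c l) {F : (Fin d' → ℝ) → ℂ}
    (hF : IntegrableOn (fun x => ((pw γ x : ℝ) : ℂ) * F x) (Rpos d')) {t : Fin d' → ℝ}
    (ht : t ∈ Cpos d') :
    IntegrableOn (fun x => ((pw γ x * kb γ c x t : ℝ) : ℂ) * F x) (Rpos d') := by
  have h1 : IntegrableOn (fun x => ((kb γ c x t : ℝ) : ℂ) * (((pw γ x : ℝ) : ℂ) * F x))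
      (Rpos d') := by
    refine Integrable.bdd_mul (c := kbd γ) hF (aesm_kb hγ t) ?_
    filter_upwards [ae_restrict_mem (measurableSet_Rpos d')] with x hx
    rw [Complex.norm_real]
    exact abs_kb_le hγ hc (fun i => (hx i).le) ht
  refine h1.congr (.of_forall fun x => ?_)
  simp only
  push_cast
  ring

lemma Good.integrable_kernel (hf : Good f) (hγ : ∀ l, 0 ≤ γ l) (hc : ∀ l, 0 < c l)
    {t : Fin (d' + d'') → ℝ} (ht : t ∈ Rpos (d' + d'')) :
    IntegrableOn (fun x => ((pw γ x * kb γ c x (tl t) : ℝ) : ℂ) * f (Fin.append x (tr t)))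
      (Rpos d') :=
  _root_.integrable_kernel hγ hc ((hf.slice (tr_mem_Rpos ht)).integrable hγ)
    (tl_mem_Cpos (Rpos_subset_Cpos _ ht))

lemma HP_add {g : (Fin (d' + d'') → ℝ) → ℂ} (hf : Good f) (hg : Good g) (hγ : ∀ l, 0 ≤ γ l)
    (hc : ∀ l, 0 < c l) {t : Fin (d' + d'') → ℝ} (ht : t ∈ Rpos (d' + d'')) :
    HP γ c (fun x => f x + g x) t = HP γ c f t + HP γ c g t := by
  simp only [HP, HT, mul_add]
  exact integral_add (hf.integrable_kernel hγ hc ht) (hg.integrable_kernel hγ hc ht)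

/-- The transform extends continuously to the closed orthant. -/
lemma Good.exists_extension_HP (hf : Good f) (hγ : ∀ l, 0 ≤ γ l) (hc : ∀ l, 0 < c l) :
    ∃ G : (Fin (d' + d'') → ℝ) → ℂ, ContinuousOn G (Cpos (d' + d'')) ∧
      ∀ t ∈ Rpos (d' + d''), G t = HP γ c f t := by
  obtain ⟨C, hC0, hC⟩ := hf.exists_majorant' hγ
  obtain ⟨⟨F, hF, hFf⟩, -⟩ := hf
  refine ⟨HP γ c F, ?_, HP_congr fun x hx => hFf x hx⟩
  have hFC : ∀ x ∈ Rpos d', ∀ y ∈ Cpos d'', pw γ x * ‖F (Fin.append x y)‖ ≤ C * dec x := by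
    intro x hx y hy
    rw [← closure_Rpos] at hy
    refine le_on_closure (s := Rpos d'') (f := fun y => pw γ x * ‖F (Fin.append x y)‖)
      (g := fun _ => C * dec x) (fun y hy => ?_) ?_ continuousOn_const hy
    · rw [hFf _ (append_mem_Rpos hx hy)]; exact hC x hx y hy
    · rw [closure_Rpos]
      refine continuousOn_const.mul (ContinuousOn.norm ?_)
      exact hF.comp (continuous_append.comp (by fun_prop : Continuous fun y : Fin d'' → ℝ =>
        (x, y))).continuousOn fun y hy => append_mem_Cpos (Rpos_subset_Cpos _ hx) hy
  unfold HP HT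
  refine continuousOn_of_dominated (bound := fun x => kbd γ * (C * dec x)) (fun t ht => ?_)
    (fun t ht => ?_) (((integrable_dec d').const_mul C).const_mul _) ?_
  · refine AEStronglyMeasurable.mul ?_ (aesm_of_continuousOn ?_)
    · simp only [Complex.ofReal_mul]
      exact (aesm_pw γ).mul (aesm_kb hγ _)
    · exact continuousOn_slice hF fun x hx =>
        append_mem_Cpos (Rpos_subset_Cpos _ hx) (tr_mem_Cpos ht)
  · filter_upwards [ae_restrict_mem (measurableSet_Rpos d')] with x hx
    rw [norm_mul, Complex.norm_real, Real.norm_eq_abs, abs_mul, mul_comm |pw γ x|, mul_assoc,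
      abs_of_nonneg (pw_nonneg fun i => (hx i).le)]
    have h0 : 0 ≤ pw γ x := pw_nonneg fun i => (hx i).le
    exact mul_le_mul (abs_kb_le hγ hc (fun i => (hx i).le) (tl_mem_Cpos ht))
      (hFC x hx _ (tr_mem_Cpos ht)) (by positivity) (kbd_nonneg γ)
  · filter_upwards [ae_restrict_mem (measurableSet_Rpos d')] with x hx
    refine ContinuousOn.mul ?_ ?_
    · refine (Complex.continuous_ofReal.comp (continuous_const.mul ?_)).continuousOn
      exact (continuous_kb_right hγ x).comp continuous_tl
    · refine hF.comp (Continuous.continuousOn ?_) fun t ht =>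
        append_mem_Cpos (Rpos_subset_Cpos _ hx) (tr_mem_Cpos ht)
      exact continuous_append.comp (continuous_const.prodMk continuous_tr)

end slices

section ibp

lemma prod_update {n : ℕ} (g : Fin n → ℝ → ℝ) (x : Fin n → ℝ) (l : Fin n) (s : ℝ) :
    ∏ i, g i (Function.update x l s i) = g l s * ∏ i ∈ univ.erase l, g i (x i) := by
  rw [← Finset.mul_prod_erase _ _ (Finset.mem_univ l), Function.update_self]
  congr 1
  exact Finset.prod_congr rfl fun i hi => by
    rw [Function.update_of_ne (Finset.ne_of_mem_erase hi)]

lemma update_mem_Rpos {n : ℕ} {x : Fin n → ℝ} (hx : x ∈ Rpos n) (l : Fin n) {s : ℝ} (hs : 0 < s) :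
    Function.update x l s ∈ Rpos n := by
  intro i
  by_cases h : i = l
  · subst h; simpa using hs
  · simpa [Function.update_of_ne h] using hx i

/-- The integral of a partial derivative over the orthant vanishes when the boundary terms do. -/
lemma integral_partial_eq_zero {n : ℕ} (l : Fin n) {Φ Ψ : (Fin n → ℝ) → ℂ}
    (hd : ∀ x ∈ Rpos n, HasDerivAt (fun s => Φ (Function.update x l s)) (Ψ x) (x l))
    (h0 : ∀ x ∈ Rpos n, Tendsto (fun s => Φ (Function.update x l s)) (nhdsWithin 0 (Set.Ioi 0))
      (nhds 0))
    (h1 : ∀ x ∈ Rpos n, Tendsto (fun s => Φ (Function.update x l s)) atTop (nhds 0))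
    (hi : IntegrableOn Ψ (Rpos n)) : ∫ x in Rpos n, Ψ x = 0 := by
  obtain ⟨n, rfl⟩ : ∃ k, n = k + 1 := ⟨n - 1, by have := l.2; omega⟩
  let e := MeasurableEquiv.piFinSuccAbove (fun _ : Fin (n + 1) => ℝ) l
  have hmp : MeasurePreserving e.symm (volume.prod volume) volume :=
    (volume_preserving_piFinSuccAbove (fun _ : Fin (n + 1) => ℝ) l).symm e
  have hpre : e.symm ⁻¹' (Rpos (n + 1)) = Set.Ioi (0 : ℝ) ×ˢ Rpos n := by
    ext ⟨s, y⟩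
    change (∀ i, 0 < l.insertNth (α := fun _ => ℝ) s y i) ↔ _
    rw [Fin.forall_iff_succAbove l]
    simp [Rpos]
  have hint : IntegrableOn (fun p : ℝ × (Fin n → ℝ) => Ψ (l.insertNth p.1 p.2))
      (Set.Ioi (0 : ℝ) ×ˢ Rpos n) (volume.prod volume) := by
    rw [← hpre]
    exact (hmp.integrableOn_comp_preimage e.symm.measurableEmbedding).2 hi
  rw [← hmp.setIntegral_preimage_emb e.symm.measurableEmbedding, hpre]
  change ∫ p in Set.Ioi (0 : ℝ) ×ˢ Rpos n, Ψ (l.insertNth (α := fun _ => ℝ) p.1 p.2)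
    ∂(volume.prod volume) = 0
  rw [IntegrableOn, ← Measure.prod_restrict] at hint
  rw [← Measure.prod_restrict, integral_prod_symm _ hint]
  have hae := hint.prod_left_ae
  refine integral_eq_zero_of_ae ?_
  filter_upwards [hae, ae_restrict_mem (measurableSet_Rpos n)] with y hy hyR
  have hmem : ∀ s > 0, l.insertNth (α := fun _ => ℝ) s y ∈ Rpos (n + 1) := fun s hs =>
    (Fin.forall_iff_succAbove l).2 (by simpa [hs] using fun i => hyR i)
  have hm1 := hmem 1 one_pos
  have hup : ∀ s s' : ℝ, Function.update (l.insertNth (α := fun _ => ℝ) s y) l s' =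
      l.insertNth (α := fun _ => ℝ) s' y := fun s s' => Fin.update_insertNth ..
  have key := integral_Ioi_of_hasDerivAt_of_tendsto (a := (0 : ℝ)) (m := (0 : ℂ))
    (f := fun s => if 0 < s then Φ (l.insertNth (α := fun _ => ℝ) s y) else 0)
    (f' := fun s => Ψ (l.insertNth (α := fun _ => ℝ) s y)) ?_ ?_ hy ?_
  · simpa using key
  · have h2 := h0 _ hm1
    simp only [hup] at h2
    rw [← continuousWithinAt_Ioi_iff_Ici]
    simp only [ContinuousWithinAt, lt_irrefl, if_false]
    refine h2.congr' ?_
    filter_upwards [self_mem_nhdsWithin] with s hs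
    rw [if_pos (Set.mem_Ioi.1 hs)]
  · intro s hs
    have h2 := hd _ (hmem s hs)
    simp only [hup, Fin.insertNth_apply_same] at h2
    refine h2.congr_of_eventuallyEq ?_
    filter_upwards [isOpen_Ioi.mem_nhds hs] with s' hs'
    rw [if_pos (Set.mem_Ioi.1 hs')]
  · have h2 := h1 _ hm1
    simp only [hup] at h2
    refine h2.congr' ?_
    filter_upwards [eventually_gt_atTop 0] with s hs
    rw [if_pos hs]

variable {d' d'' : ℕ} {γ c : Fin d' → ℝ} {f : (Fin (d' + d'') → ℝ) → ℂ}

/-- Unit increment of the order at one coordinate. -/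
def inc (γ : Fin d' → ℝ) (l : Fin d') : Fin d' → ℝ := Function.update γ l (γ l + 1)

lemma inc_nonneg (hγ : ∀ l, 0 ≤ γ l) (l : Fin d') : ∀ i, 0 ≤ inc γ l i := by
  intro i
  by_cases h : i = l
  · subst h; simp only [inc, Function.update_self]; linarith [hγ i]
  · simpa [inc, Function.update_of_ne h] using hγ i

lemma pw_inc {x : Fin d' → ℝ} (hx : x ∈ Rpos d') (l : Fin d') : pw (inc γ l) x = x l * pw γ x := by
  rw [pw, pw, ← Finset.mul_prod_erase _ _ (Finset.mem_univ l),
    ← Finset.mul_prod_erase univ (fun l => x l ^ γ l) (Finset.mem_univ l), ← mul_assoc]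
  congr 1
  · simp only [inc, Function.update_self]
    rw [Real.rpow_add (hx l), Real.rpow_one, mul_comm]
  · refine Finset.prod_congr rfl fun i hi => ?_
    rw [inc, Function.update_of_ne (Finset.ne_of_mem_erase hi)]

lemma dec_update_le {x : Fin d' → ℝ} (hx : x ∈ Rpos d') (l : Fin d') {s : ℝ} (hs : 0 < s) :
    dec (Function.update x l s) ≤ ((1 + s) ^ 2)⁻¹ := by
  rw [dec, prod_update (fun _ s => ((1 + s) ^ 2)⁻¹)]
  refine mul_le_of_le_one_right (by positivity) ?_
  refine Finset.prod_le_one (fun i _ => by positivity) fun i _ => ?_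
  exact inv_le_one_of_one_le₀ (one_le_pow₀ (by linarith [hx i]))

lemma append_update (x : Fin d' → ℝ) (y : Fin d'' → ℝ) (l : Fin d') (s : ℝ) :
    Fin.append (Function.update x l s) y =
      Function.update (Fin.append x y) (Fin.castAdd d'' l) s := by
  ext i
  refine Fin.addCases (fun k => ?_) (fun k => ?_) i
  · by_cases h : k = l
    · subst h; simp
    · have : Fin.castAdd d'' k ≠ Fin.castAdd d'' l := fun h' => h (Fin.castAdd_injective _ _ h')
      simp [Function.update_of_ne h, Function.update_of_ne this]
  · have : Fin.natAdd d' k ≠ Fin.castAdd d'' l := fun h' => by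
      have := congrArg Fin.val h'; simp at this; have := l.2; omega
    simp [Function.update_of_ne this]

lemma hasDerivAt_slice (hf : Smooth f) {x : Fin d' → ℝ} (hx : x ∈ Rpos d') {y : Fin d'' → ℝ}
    (hy : y ∈ Rpos d'') (l : Fin d') :
    HasDerivAt (fun s => f (Fin.append (Function.update x l s) y))
      (pd (Fin.castAdd d'' l) f (Fin.append x y)) (x l) := by
  simp only [append_update]
  have h1 := hasDerivAt_update (𝕜 := ℝ) (Fin.append x y) (Fin.castAdd d'' l) (x l)
  have h2 : Function.update (Fin.append x y) (Fin.castAdd d'' l) (x l) = Fin.append x y := by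
    rw [Function.update_eq_self_iff]; simp
  refine HasFDerivAt.comp_hasDerivAt (x l) ?_ h1
  rw [h2]
  exact (hf.differentiableAt (append_mem_Rpos hx hy)).hasFDerivAt

/-- Vanishing of boundary terms for `x^{γ+e_l} · (bounded) · f`. -/
lemma tendsto_boundary (hf : Good f) (hγ : ∀ l, 0 ≤ γ l) (l : Fin d') {y : Fin d'' → ℝ}
    (hy : y ∈ Rpos d'') {K : (Fin d' → ℝ) → ℝ} {B : ℝ} (hK : ∀ x ∈ Rpos d', |K x| ≤ B)
    {x : Fin d' → ℝ} (hx : x ∈ Rpos d') :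
    Tendsto (fun s => ((pw (inc γ l) (Function.update x l s) * K (Function.update x l s) : ℝ) : ℂ) *
      f (Fin.append (Function.update x l s) y)) (nhdsWithin 0 (Set.Ioi 0)) (nhds 0) ∧
    Tendsto (fun s => ((pw (inc γ l) (Function.update x l s) * K (Function.update x l s) : ℝ) : ℂ) *
      f (Fin.append (Function.update x l s) y)) atTop (nhds 0) := by
  have hB : 0 ≤ B := (abs_nonneg _).trans (hK x hx)
  constructor
  · obtain ⟨C, hC0, hC⟩ := hf.exists_majorant' hγ
    have ht : Tendsto (fun s : ℝ => s * (B * C)) (nhdsWithin 0 (Set.Ioi 0)) (nhds 0) := by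
      have : Tendsto (fun s : ℝ => s * (B * C)) (nhds 0) (nhds (0 * (B * C))) :=
        (continuous_id.mul continuous_const).tendsto 0
      rw [zero_mul] at this
      exact this.mono_left nhdsWithin_le_nhds
    refine squeeze_zero_norm' ?_ ht
    filter_upwards [self_mem_nhdsWithin] with s hs
    have hs : 0 < s := hs
    have hu := update_mem_Rpos hx l hs
    have h1 := hC _ hu y hy
    have h2 : dec (Function.update x l s) ≤ 1 := (dec_update_le hx l hs).trans
      (inv_le_one_of_one_le₀ (one_le_pow₀ (by linarith)))
    have h3 := hK _ hu
    have h4 : 0 ≤ pw γ (Function.update x l s) := pw_nonneg fun i => (hu i).le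
    rw [pw_inc hu, norm_mul, Complex.norm_real, Real.norm_eq_abs, abs_mul, abs_mul,
      Function.update_self, abs_of_pos hs, abs_of_nonneg h4]
    calc _ = s * (|K (Function.update x l s)| *
          (pw γ (Function.update x l s) * ‖f (Fin.append (Function.update x l s) y)‖)) := by ring
      _ ≤ s * (B * (C * 1)) := by
        have h5 : C * dec (Function.update x l s) ≤ C * 1 := by gcongr
        have h6 := mul_le_mul h3 (h1.trans h5) (by positivity) hB
        gcongr
      _ = _ := by ring
  · obtain ⟨C, hC0, hC⟩ := hf.exists_majorant' (inc_nonneg hγ l)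
    have ht : Tendsto (fun s : ℝ => B * C * ((1 + s) ^ 2)⁻¹) atTop (nhds 0) := by
      have h1 : Tendsto (fun s : ℝ => ((1 + s) ^ 2)⁻¹) atTop (nhds 0) :=
        tendsto_inv_atTop_zero.comp ((tendsto_pow_atTop two_ne_zero).comp
          (tendsto_atTop_add_const_left _ _ tendsto_id))
      simpa using h1.const_mul (B * C)
    refine squeeze_zero_norm' ?_ ht
    filter_upwards [eventually_gt_atTop 0] with s hs
    have hu := update_mem_Rpos hx l hs
    have h1 := hC _ hu y hy
    have h2 := dec_update_le hx l hs
    have h3 := hK _ hu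
    have h4 : 0 ≤ pw (inc γ l) (Function.update x l s) := pw_nonneg fun i => (hu i).le
    rw [norm_mul, Complex.norm_real, Real.norm_eq_abs, abs_mul, abs_of_nonneg h4]
    calc _ = |K (Function.update x l s)| * (pw (inc γ l) (Function.update x l s) *
          ‖f (Fin.append (Function.update x l s) y)‖) := by ring
      _ ≤ B * (C * ((1 + s) ^ 2)⁻¹) := by
        have h5 : C * dec (Function.update x l s) ≤ C * ((1 + s) ^ 2)⁻¹ := by gcongr
        exact mul_le_mul h3 (h1.trans h5) (by positivity) hB
      _ = _ := by ring

lemma pw_mul_kb (γ γ' c x t : Fin d' → ℝ) :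
    pw γ x * kb γ' c x t = ∏ i, (x i ^ γ i * bk (γ' i) (c i * x i * t i)) := by
  rw [pw, kb, Finset.prod_mul_distrib]

/-- Integration by parts lowering the order. -/
lemma HP_inc_pd (hf : SS f) (hγ : ∀ l, 0 ≤ γ l) (hc : ∀ l, 0 < c l) (l : Fin d')
    {t : Fin (d' + d'') → ℝ} (ht : t ∈ Rpos (d' + d'')) :
    HP (inc γ l) c (pd (Fin.castAdd d'' l) f) t = -HP γ c f t := by
  have hi := inc_nonneg hγ l
  have i1 := (hf.pd (Fin.castAdd d'' l)).good.integrable_kernel hi hc ht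
  have i2 := hf.good.integrable_kernel hγ hc ht
  have hb := fun x (hx : x ∈ Rpos d') => tendsto_boundary hf.good hγ l (tr_mem_Rpos ht)
    (K := fun x => kb (inc γ l) c x (tl t)) (B := kbd (inc γ l))
    (fun x hx => abs_kb_le hi hc (fun i => (hx i).le) (tl_mem_Cpos (Rpos_subset_Cpos _ ht))) hx
  rw [eq_neg_iff_add_eq_zero]
  refine (integral_add i1 i2).symm.trans ?_
  refine integral_partial_eq_zero l (Φ := fun x => ((pw (inc γ l) x * kb (inc γ l) c x (tl t) : ℝ) :
    ℂ) * f (Fin.append x (tr t))) (fun x hx => ?_) (fun x hx => (hb x hx).1)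
    (fun x hx => (hb x hx).2) (i1.add i2)
  have hP : ∀ (γ₁ γ₂ : Fin d' → ℝ) s, pw γ₁ (Function.update x l s) *
      kb γ₂ c (Function.update x l s) (tl t) = s ^ γ₁ l * bk (γ₂ l) (c l * s * tl t l) *
        ∏ i ∈ univ.erase l, (x i ^ γ₁ i * bk (γ₂ i) (c i * x i * tl t i)) := fun γ₁ γ₂ s => by
    rw [pw_mul_kb, prod_update (fun i s => s ^ γ₁ i * bk (γ₂ i) (c i * s * tl t i))]
  have hE : ∏ i ∈ univ.erase l, (x i ^ inc γ l i * bk (inc γ l i) (c i * x i * tl t i)) =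
      ∏ i ∈ univ.erase l, (x i ^ γ i * bk (γ i) (c i * x i * tl t i)) :=
    Finset.prod_congr rfl fun i hi => by
      rw [inc, Function.update_of_ne (Finset.ne_of_mem_erase hi)]
  have h1 : HasDerivAt (fun s => pw (inc γ l) (Function.update x l s) *
      kb (inc γ l) c (Function.update x l s) (tl t)) (pw γ x * kb γ c x (tl t)) (x l) := by
    have e0 := hP γ γ (x l)
    rw [Function.update_eq_self] at e0
    rw [e0]
    simp only [hP, hE]
    refine HasDerivAt.mul_const ?_ _
    simp only [inc, Function.update_self]
    have hx0 := hx l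
    have hγ1 : 0 ≤ γ l + 1 := by linarith [hγ l]
    have a1 := Real.hasDerivAt_rpow_const (x := x l) (p := γ l + 1) (Or.inl hx0.ne')
    have a2 : HasDerivAt (fun s => c l * s * tl t l) (c l * tl t l) (x l) := by
      simpa using ((hasDerivAt_id (x l)).const_mul (c l)).mul_const (tl t l)
    have a3 := (hasDerivAt_bk hγ1 (c l * x l * tl t l)).comp (x l) a2
    have a4 := a1.mul a3
    refine a4.congr_deriv ?_
    rw [← bk_recurrence (hγ l), add_sub_cancel_right, Real.rpow_add hx0, Real.rpow_one,
      show γ l + 1 + 1 = γ l + 2 by ring]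
    simp only [Function.comp_apply]
    ring
  have h2 := (h1.ofReal_comp).mul (hasDerivAt_slice hf.smooth hx (tr_mem_Rpos ht) l)
  refine h2.congr_deriv ?_
  simp only [Function.update_eq_self]
  ring

/-- Integration by parts for the multiplication by a transformed coordinate. -/
lemma coord_mul_HP_inc (hf : SS f) (hγ : ∀ l, 0 ≤ γ l) (hc : ∀ l, 0 < c l) (l : Fin d')
    {t : Fin (d' + d'') → ℝ} (ht : t ∈ Rpos (d' + d'')) :
    (c l : ℂ) * t (Fin.castAdd d'' l) * HP (inc γ l) c f t =
      HP γ c (fun x => (γ l + 1 : ℂ) * f x +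
        (x (Fin.castAdd d'' l) : ℂ) * pd (Fin.castAdd d'' l) f x) t := by
  have hi := inc_nonneg hγ l
  have hs := (hf.const_mul (γ l + 1)).add
    ((hf.pd (Fin.castAdd d'' l)).coord_mul (Fin.castAdd d'' l))
  have i1 := (hf.good.integrable_kernel hi hc ht).const_mul ((c l : ℂ) * t (Fin.castAdd d'' l))
  have i2 := hs.good.integrable_kernel hγ hc ht
  have hb := fun x (hx : x ∈ Rpos d') => tendsto_boundary hf.good hγ l (tr_mem_Rpos ht)
    (K := fun x => kb γ c x (tl t)) (B := kbd γ)
    (fun x hx => abs_kb_le hγ hc (fun i => (hx i).le) (tl_mem_Cpos (Rpos_subset_Cpos _ ht))) hx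
  rw [eq_comm, ← sub_eq_zero]
  simp only [HP, HT, ← integral_const_mul]
  refine (integral_sub i2 i1).symm.trans ?_
  refine integral_partial_eq_zero l (Φ := fun x => ((pw (inc γ l) x * kb γ c x (tl t) : ℝ) :
    ℂ) * f (Fin.append x (tr t))) (fun x hx => ?_) (fun x hx => (hb x hx).1)
    (fun x hx => (hb x hx).2) (i2.sub i1)
  have hP : ∀ (γ₁ γ₂ : Fin d' → ℝ) s, pw γ₁ (Function.update x l s) *
      kb γ₂ c (Function.update x l s) (tl t) = s ^ γ₁ l * bk (γ₂ l) (c l * s * tl t l) *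
        ∏ i ∈ univ.erase l, (x i ^ γ₁ i * bk (γ₂ i) (c i * x i * tl t i)) := fun γ₁ γ₂ s => by
    rw [pw_mul_kb, prod_update (fun i s => s ^ γ₁ i * bk (γ₂ i) (c i * s * tl t i))]
  have hne : ∀ i ∈ univ.erase l, inc γ l i = γ i := fun i hi => by
    rw [inc, Function.update_of_ne (Finset.ne_of_mem_erase hi)]
  have hE : ∏ i ∈ univ.erase l, (x i ^ inc γ l i * bk (inc γ l i) (c i * x i * tl t i)) =
      ∏ i ∈ univ.erase l, (x i ^ γ i * bk (γ i) (c i * x i * tl t i)) :=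
    Finset.prod_congr rfl fun i hi => by rw [hne i hi]
  have hE' : ∏ i ∈ univ.erase l, (x i ^ inc γ l i * bk (γ i) (c i * x i * tl t i)) =
      ∏ i ∈ univ.erase l, (x i ^ γ i * bk (γ i) (c i * x i * tl t i)) :=
    Finset.prod_congr rfl fun i hi => by rw [hne i hi]
  have h1 : HasDerivAt (fun s => pw (inc γ l) (Function.update x l s) *
      kb γ c (Function.update x l s) (tl t))
      ((γ l + 1) * (pw γ x * kb γ c x (tl t)) -
        c l * tl t l * (pw (inc γ l) x * kb (inc γ l) c x (tl t))) (x l) := by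
    have e0 := hP γ γ (x l)
    have e1 := hP (inc γ l) (inc γ l) (x l)
    rw [Function.update_eq_self] at e0 e1
    rw [e0, e1]
    simp only [hP]
    rw [hE, hE']
    simp only [inc, Function.update_self]
    have hx0 := hx l
    have a1 := Real.hasDerivAt_rpow_const (x := x l) (p := γ l + 1) (Or.inl hx0.ne')
    have a2 : HasDerivAt (fun s => c l * s * tl t l) (c l * tl t l) (x l) := by
      simpa using ((hasDerivAt_id (x l)).const_mul (c l)).mul_const (tl t l)
    have a3 := (hasDerivAt_bk (hγ l) (c l * x l * tl t l)).comp (x l) a2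
    have a4 := (a1.mul a3).mul_const
      (∏ i ∈ univ.erase l, (x i ^ γ i * bk (γ i) (c i * x i * tl t i)))
    refine a4.congr_deriv ?_
    rw [add_sub_cancel_right]
    simp only [Function.comp_apply]
    ring
  have h2 := (h1.ofReal_comp).mul (hasDerivAt_slice hf.smooth hx (tr_mem_Rpos ht) l)
  refine h2.congr_deriv ?_
  simp only [Function.update_eq_self, pw_inc hx, Fin.append_left, tl]
  push_cast
  ring

lemma coord_mul_HP (hf : SS f) (hγ : ∀ l, 0 ≤ γ l) (hc : ∀ l, 0 < c l) (i : Fin (d' + d'')) :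
    ∃ g, SS g ∧ ∀ t ∈ Rpos (d' + d''), (t i : ℂ) * HP γ c f t = HP γ c g t := by
  refine Fin.addCases (fun l => ?_) (fun j => ?_) i
  · set i := Fin.castAdd d'' l
    have hs := (((hf.pd i).const_mul (γ l + 1)).add (((hf.pd i).pd i).coord_mul i))
    refine ⟨_, hs.const_mul (-(c l : ℂ)⁻¹), fun t ht => ?_⟩
    have h1 := coord_mul_HP_inc (hf.pd i) hγ hc l ht
    rw [HP_inc_pd hf hγ hc l ht] at h1
    rw [HP_const_mul, ← h1]
    have : (c l : ℂ) ≠ 0 := Complex.ofReal_ne_zero.2 (hc l).ne'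
    field_simp
    exact mul_comm _ _
  · refine ⟨_, hf.coord_mul (Fin.natAdd d' j), fun t ht => ?_⟩
    simp only [HP, HT, ← integral_const_mul, Fin.append_right]
    refine integral_congr_ae (.of_forall fun x => ?_)
    simp only [tr]
    ring

end ibp

section deriv

/-- The coordinate functional. -/
def pj {n : ℕ} (i : Fin n) : (Fin n → ℝ) →L[ℝ] ℝ :=
  ContinuousLinearMap.proj (R := ℝ) (φ := fun _ : Fin n => ℝ) i

@[simp] lemma pj_apply {n : ℕ} (i : Fin n) (v : Fin n → ℝ) : pj i v = v i := rfl

lemma norm_pj_le {n : ℕ} (i : Fin n) : ‖pj i‖ ≤ 1 :=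
  ContinuousLinearMap.opNorm_le_bound _ zero_le_one fun v => by
    rw [one_mul]; exact norm_le_pi_norm v i

lemma continuous_smulRight_pj {n : ℕ} (i : Fin n) :
    Continuous fun z : ℂ => (pj i).smulRight z :=
  (ContinuousLinearMap.smulRightL ℝ (Fin n → ℝ) ℂ (pj i)).continuous

lemma norm_smulRight_pj_le {n : ℕ} (i : Fin n) (z : ℂ) : ‖(pj i).smulRight z‖ ≤ ‖z‖ := by
  rw [ContinuousLinearMap.norm_smulRight_apply]
  exact mul_le_of_le_one_left (norm_nonneg _) (norm_pj_le i)

/-- A differentiable function on the orthant is as smooth as its partial derivatives allow. -/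
lemma Smooth.of_invariant {d : ℕ} (A : Set ((Fin d → ℝ) → ℂ))
    (h1 : ∀ f ∈ A, ∀ x ∈ Rpos d, DifferentiableAt ℝ f x)
    (h2 : ∀ f ∈ A, ∀ j, ∃ g ∈ A, Set.EqOn g (_root_.pd j f) (Rpos d)) : ∀ f ∈ A, Smooth f := by
  intro f hf
  refine contDiffOn_infty.2 fun n => ?_
  induction n generalizing f with
  | zero =>
    exact contDiffOn_zero.2 fun x hx => (h1 f hf x hx).continuousAt.continuousWithinAt
  | succ n ih =>
    refine (contDiffOn_succ_iff_fderiv_of_isOpen (isOpen_Rpos d)).2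
      ⟨fun x hx => (h1 f hf x hx).differentiableWithinAt, fun h => absurd h (by exact_mod_cast WithTop.natCast_ne_top n), ?_⟩
    have e : fderiv ℝ f = fun x => ∑ j, (pj j).smulRight (_root_.pd j f x) := by
      ext x v
      conv_lhs => rw [pi_eq_sum_univ' v]
      simp [_root_.pd]
    rw [e]
    refine ContDiffOn.sum fun j _ => ?_
    obtain ⟨g, hg, hgf⟩ := h2 f hf j
    have h3 : ContDiffOn ℝ n (_root_.pd j f) (Rpos d) := (ih g hg).congr fun x hx => (hgf hx).symm
    exact (ContinuousLinearMap.smulRightL ℝ (Fin d → ℝ) ℂ (pj j)).contDiff.comp_contDiffOn h3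

variable {d' d'' : ℕ} {γ c : Fin d' → ℝ} {f : (Fin (d' + d'') → ℝ) → ℂ}

/-- The integrand of `HP`. -/
def hker (γ c : Fin d' → ℝ) (f : (Fin (d' + d'') → ℝ) → ℂ) (t : Fin (d' + d'') → ℝ)
    (x : Fin d' → ℝ) : ℂ :=
  ((pw γ x * kb γ c x (tl t) : ℝ) : ℂ) * f (Fin.append x (tr t))

/-- The derivative of the integrand of `HP` in the parameter. -/
def dhker (γ c : Fin d' → ℝ) (f : (Fin (d' + d'') → ℝ) → ℂ) (t : Fin (d' + d'') → ℝ)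
    (x : Fin d' → ℝ) : (Fin (d' + d'') → ℝ) →L[ℝ] ℂ :=
  (∑ l, (pj (Fin.castAdd d'' l)).smulRight (-(c l : ℂ) * hker (inc γ l) c f t x)) +
    ∑ j, (pj (Fin.natAdd d' j)).smulRight (hker γ c (pd (Fin.natAdd d' j) f) t x)

lemma norm_ker_le (hγ : ∀ l, 0 ≤ γ l) (hc : ∀ l, 0 < c l) {C : ℝ}
    (hC : ∀ x ∈ Rpos d', ∀ y ∈ Rpos d'', pw γ x * ‖f (Fin.append x y)‖ ≤ C * dec x)
    {t : Fin (d' + d'') → ℝ} (ht : t ∈ Rpos (d' + d'')) {x : Fin d' → ℝ} (hx : x ∈ Rpos d') :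
    ‖hker γ c f t x‖ ≤ kbd γ * (C * dec x) := by
  have h0 : 0 ≤ pw γ x := pw_nonneg fun i => (hx i).le
  rw [hker, norm_mul, Complex.norm_real, Real.norm_eq_abs, abs_mul, mul_comm |pw γ x|, mul_assoc,
    abs_of_nonneg h0]
  exact mul_le_mul (abs_kb_le hγ hc (fun i => (hx i).le) fun i => (tl_mem_Rpos ht i).le)
    (hC x hx _ (tr_mem_Rpos ht)) (by positivity) (kbd_nonneg γ)

lemma kb_inc (l : Fin d') (x t : Fin d' → ℝ) : kb (inc γ l) c x t =
    bk (γ l + 1) (c l * x l * t l) * ∏ i ∈ univ.erase l, bk (γ i) (c i * x i * t i) := by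
  rw [kb, ← Finset.mul_prod_erase _ _ (Finset.mem_univ l)]
  congr 1
  · simp [inc]
  · refine Finset.prod_congr rfl fun i hi => ?_
    rw [inc, Function.update_of_ne (Finset.ne_of_mem_erase hi)]

lemma hasFDerivAt_kb (hγ : ∀ l, 0 ≤ γ l) (x : Fin d' → ℝ) (t : Fin (d' + d'') → ℝ) :
    HasFDerivAt (fun t : Fin (d' + d'') → ℝ => kb γ c x (tl t))
      (∑ l, (-(c l * x l * kb (inc γ l) c x (tl t))) • pj (Fin.castAdd d'' l)) t := by
  have h : ∀ l ∈ (univ : Finset (Fin d')), HasFDerivAt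
      (fun t : Fin (d' + d'') → ℝ => bk (γ l) (c l * x l * t (Fin.castAdd d'' l)))
      ((-bk (γ l + 1) (c l * x l * t (Fin.castAdd d'' l))) • ((c l * x l) • pj (Fin.castAdd d'' l)))
      t := fun l _ =>
    (hasDerivAt_bk (hγ l) _).comp_hasFDerivAt t
      ((pj (Fin.castAdd d'' l)).hasFDerivAt.const_mul (c l * x l))
  refine (HasFDerivAt.finsetProd h).congr_fderiv (Finset.sum_congr rfl fun l _ => ?_)
  rw [kb_inc, smul_smul, smul_smul]
  congr 1
  simp only [tl]
  ring

lemma hasFDerivAt_slice (hf : Smooth f) {x : Fin d' → ℝ} (hx : x ∈ Rpos d')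
    {t : Fin (d' + d'') → ℝ} (ht : t ∈ Rpos (d' + d'')) :
    HasFDerivAt (fun t : Fin (d' + d'') → ℝ => f (Fin.append x (tr t)))
      (∑ j, (pj (Fin.natAdd d' j)).smulRight (pd (Fin.natAdd d' j) f (Fin.append x (tr t)))) t := by
  let T : (Fin (d' + d'') → ℝ) →L[ℝ] (Fin (d' + d'') → ℝ) :=
    ∑ j, (pj (Fin.natAdd d' j)).smulRight (Pi.single (Fin.natAdd d' j) (1 : ℝ))
  have hT : HasFDerivAt (fun t : Fin (d' + d'') → ℝ => Fin.append x (tr t)) T t := by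
    have e : (fun t : Fin (d' + d'') → ℝ => Fin.append x (tr t)) =
        fun t => T t + Fin.append x 0 := by
      ext t i
      simp only [T, _root_.sum_apply, ContinuousLinearMap.smulRight_apply,
        Pi.add_apply, Finset.sum_apply, Pi.smul_apply, pj_apply, smul_eq_mul]
      refine Fin.addCases (fun l => ?_) (fun j => ?_) i
      · have : ∀ j, Fin.castAdd d'' l ≠ Fin.natAdd d' j := fun j h => by
          have := congrArg Fin.val h; simp at this; have := l.2; omega
        simp [this]
      · simp [Pi.single_apply, tr]
    rw [e]
    exact T.hasFDerivAt.add_const _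
  have h1 := (hf.differentiableAt (append_mem_Rpos hx (tr_mem_Rpos ht))).hasFDerivAt
  refine (h1.comp t hT).congr_fderiv ?_
  ext v
  simp [T, pd]

lemma hasFDerivAt_ker (hf : Smooth f) (hγ : ∀ l, 0 ≤ γ l) {x : Fin d' → ℝ} (hx : x ∈ Rpos d')
    {t : Fin (d' + d'') → ℝ} (ht : t ∈ Rpos (d' + d'')) :
    HasFDerivAt (fun t => hker γ c f t x) (dhker γ c f t x) t := by
  have h1 := Complex.ofRealCLM.hasFDerivAt.comp t
    ((hasFDerivAt_kb (c := c) (d'' := d'') hγ x t).const_mul (pw γ x))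
  refine (h1.mul (hasFDerivAt_slice hf hx ht)).congr_fderiv ?_
  ext v
  simp only [dhker, hker, _root_.add_apply, _root_.smul_apply,
    ContinuousLinearMap.comp_apply, _root_.sum_apply, Function.comp_apply,
    ContinuousLinearMap.smulRight_apply, pj_apply, Complex.ofRealCLM_apply, smul_eq_mul,
    Complex.real_smul, pw_inc hx]
  push_cast
  rw [add_comm]
  congr 1
  · rw [Finset.mul_sum, Finset.mul_sum]
    refine Finset.sum_congr rfl fun l _ => ?_
    ring
  · rw [Finset.mul_sum]
    refine Finset.sum_congr rfl fun l _ => ?_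
    ring

lemma aesm_dker (hf : SS f) (hγ : ∀ l, 0 ≤ γ l) (hc : ∀ l, 0 < c l)
    {t : Fin (d' + d'') → ℝ} (ht : t ∈ Rpos (d' + d'')) :
    AEStronglyMeasurable (dhker γ c f t) (volume.restrict (Rpos d')) := by
  refine AEStronglyMeasurable.add (Finset.aestronglyMeasurable_fun_sum _ fun l _ => ?_)
    (Finset.aestronglyMeasurable_fun_sum _ fun j _ => ?_)
  · exact (continuous_smulRight_pj _).comp_aestronglyMeasurable
      ((hf.good.integrable_kernel (inc_nonneg hγ l) hc ht).1.const_mul _)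
  · exact (continuous_smulRight_pj _).comp_aestronglyMeasurable
      ((hf.pd (Fin.natAdd d' j)).good.integrable_kernel hγ hc ht).1

lemma exists_dker_bound (hf : SS f) (hγ : ∀ l, 0 ≤ γ l) (hc : ∀ l, 0 < c l) :
    ∃ C, ∀ t ∈ Rpos (d' + d''), ∀ x ∈ Rpos d', ‖dhker γ c f t x‖ ≤ C * dec x := by
  choose C hC0 hC using fun l => hf.good.exists_majorant' (inc_nonneg hγ l)
  choose D hD0 hD using fun j => (hf.pd (Fin.natAdd d' j)).good.exists_majorant' hγ
  refine ⟨∑ l, c l * (kbd (inc γ l) * C l) + ∑ j, kbd γ * D j, fun t ht x hx => ?_⟩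
  refine (norm_add_le _ _).trans ?_
  rw [add_mul, Finset.sum_mul, Finset.sum_mul]
  refine add_le_add ((norm_sum_le _ _).trans (Finset.sum_le_sum fun l _ => ?_))
    ((norm_sum_le _ _).trans (Finset.sum_le_sum fun j _ => ?_))
  · refine (norm_smulRight_pj_le _ _).trans ?_
    rw [norm_mul, norm_neg, Complex.norm_real, Real.norm_of_nonneg (hc l).le, mul_assoc, mul_assoc]
    exact mul_le_mul_of_nonneg_left (norm_ker_le (inc_nonneg hγ l) hc (hC l) ht hx) (hc l).le
  · refine (norm_smulRight_pj_le _ _).trans ?_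
    rw [mul_assoc]
    exact norm_ker_le hγ hc (hD j) ht hx

lemma hasFDerivAt_HP (hf : SS f) (hγ : ∀ l, 0 ≤ γ l) (hc : ∀ l, 0 < c l)
    {t : Fin (d' + d'') → ℝ} (ht : t ∈ Rpos (d' + d'')) :
    HasFDerivAt (HP γ c f) (∫ x in Rpos d', dhker γ c f t x) t := by
  obtain ⟨C, hC⟩ := exists_dker_bound hf hγ hc
  have hn := (isOpen_Rpos (d' + d'')).mem_nhds ht
  refine hasFDerivAt_integral_of_dominated_of_fderiv_le (F := hker γ c f)
    (bound := fun x => C * dec x) hn ?_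
    (hf.good.integrable_kernel hγ hc ht) (aesm_dker hf hγ hc ht) ?_
    ((integrable_dec d').const_mul C) ?_
  · filter_upwards [hn] with t ht
    exact (hf.good.integrable_kernel hγ hc ht).1
  · filter_upwards [ae_restrict_mem (measurableSet_Rpos d')] with x hx t ht
    exact hC t ht x hx
  · filter_upwards [ae_restrict_mem (measurableSet_Rpos d')] with x hx t ht
    exact hasFDerivAt_ker hf.smooth hγ hx ht

lemma integrable_dker (hf : SS f) (hγ : ∀ l, 0 ≤ γ l) (hc : ∀ l, 0 < c l)
    {t : Fin (d' + d'') → ℝ} (ht : t ∈ Rpos (d' + d'')) :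
    IntegrableOn (dhker γ c f t) (Rpos d') := by
  obtain ⟨C, hC⟩ := exists_dker_bound hf hγ hc
  refine Integrable.mono' ((integrable_dec d').const_mul C) (aesm_dker hf hγ hc ht) ?_
  filter_upwards [ae_restrict_mem (measurableSet_Rpos d')] with x hx
  exact hC t ht x hx

lemma pd_castAdd_HP (hf : SS f) (hγ : ∀ l, 0 ≤ γ l) (hc : ∀ l, 0 < c l) (l : Fin d') :
    Set.EqOn (pd (Fin.castAdd d'' l) (HP γ c f)) (fun t => -(c l : ℂ) * HP (inc γ l) c f t)
      (Rpos (d' + d'')) := by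
  intro t ht
  rw [pd, (hasFDerivAt_HP hf hγ hc ht).fderiv,
    ContinuousLinearMap.integral_apply (integrable_dker hf hγ hc ht)]
  simp only [HP, HT]
  rw [← integral_const_mul]
  refine integral_congr_ae (.of_forall fun x => ?_)
  have h : ∀ j, Fin.natAdd d' j ≠ Fin.castAdd d'' l := fun j h => by
    have := congrArg Fin.val h; simp at this; have := l.2; omega
  simp [dhker, Pi.single_apply, h, hker]

lemma pd_natAdd_HP (hf : SS f) (hγ : ∀ l, 0 ≤ γ l) (hc : ∀ l, 0 < c l) (j : Fin d'') :
    Set.EqOn (pd (Fin.natAdd d' j) (HP γ c f)) (HP γ c (pd (Fin.natAdd d' j) f))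
      (Rpos (d' + d'')) := by
  intro t ht
  rw [pd, (hasFDerivAt_HP hf hγ hc ht).fderiv,
    ContinuousLinearMap.integral_apply (integrable_dker hf hγ hc ht)]
  simp only [HP, HT]
  refine integral_congr_ae (.of_forall fun x => ?_)
  have h : ∀ l, Fin.castAdd d'' l ≠ Fin.natAdd d' j := fun l h => by
    have := congrArg Fin.val h; simp at this; have := l.2; omega
  simp [dhker, Pi.single_apply, h, hker]

lemma exists_HP_mul (hγ : ∀ l, 0 ≤ γ l) (hc : ∀ l, 0 < c l) (N : ℕ) :
    ∀ f : (Fin (d' + d'') → ℝ) → ℂ, SS f → ∃ g, SS g ∧ ∀ t ∈ Rpos (d' + d''),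
      ((∏ i, (1 + t i) ^ N : ℝ) : ℂ) * HP γ c f t = HP γ c g t := by
  let M : ((Fin (d' + d'') → ℝ) → ℝ) → Prop := fun P =>
    ∀ f : (Fin (d' + d'') → ℝ) → ℂ, SS f → ∃ g, SS g ∧ ∀ t ∈ Rpos (d' + d''),
      ((P t : ℝ) : ℂ) * HP γ c f t = HP γ c g t
  have m1 : M 1 := fun f hf => ⟨f, hf, fun t _ => by simp⟩
  have mm : ∀ P Q, M P → M Q → M (P * Q) := by
    intro P Q hP hQ f hf
    obtain ⟨g, hg, h1⟩ := hQ f hf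
    obtain ⟨g', hg', h2⟩ := hP g hg
    refine ⟨g', hg', fun t ht => ?_⟩
    rw [Pi.mul_apply, Complex.ofReal_mul, mul_assoc, h1 t ht, h2 t ht]
  have mc : ∀ i, M (fun t => 1 + t i) := by
    intro i f hf
    obtain ⟨g, hg, h⟩ := coord_mul_HP hf hγ hc i
    refine ⟨_, hf.add hg, fun t ht => ?_⟩
    rw [HP_add hf.good hg.good hγ hc ht, ← h t ht]
    push_cast
    ring
  have mp : ∀ i (n : ℕ), M ((fun t => 1 + t i) ^ n) := fun i n => by
    induction n with
    | zero => simpa using m1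
    | succ n ih => rw [pow_succ]; exact mm _ _ ih (mc i)
  have := Finset.prod_induction (s := univ)
    (fun i : Fin (d' + d'') => (fun t : Fin (d' + d'') → ℝ => 1 + t i) ^ N) M mm m1
    fun i _ => mp i N
  intro f hf
  obtain ⟨g, hg, h⟩ := this f hf
  refine ⟨g, hg, fun t ht => ?_⟩
  rw [← h t ht]
  simp

lemma good_HP (hf : SS f) (hγ : ∀ l, 0 ≤ γ l) (hc : ∀ l, 0 < c l) : Good (HP γ c f) := by
  refine ⟨hf.good.exists_extension_HP hγ hc, fun N => ?_⟩
  obtain ⟨g, hg, h⟩ := exists_HP_mul hγ hc N f hf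
  obtain ⟨C, hC⟩ := hg.good.exists_norm_HP_le hγ hc
  refine ⟨C, fun t ht => ?_⟩
  have := hC t ht
  rwa [← h t ht, norm_mul, Complex.norm_real, Real.norm_of_nonneg (prod_one_add_pos ht N).le] at this

/-- The partial transform preserves the space `S(ℝ^d₊)`. -/
lemma SS_HP (hf : SS f) (hγ : ∀ l, 0 ≤ γ l) (hc : ∀ l, 0 < c l) : SS (HP γ c f) := by
  have main : ∀ u ∈ {u | ∃ (a : ℂ) (γ : Fin d' → ℝ) (f : (Fin (d' + d'') → ℝ) → ℂ),
      (∀ l, 0 ≤ γ l) ∧ SS f ∧ u = fun t => a * HP γ c f t}, SS u := by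
    have hinv : ∀ u ∈ {u | ∃ (a : ℂ) (γ : Fin d' → ℝ) (f : (Fin (d' + d'') → ℝ) → ℂ),
        (∀ l, 0 ≤ γ l) ∧ SS f ∧ u = fun t => a * HP γ c f t}, ∀ j,
        ∃ g ∈ {u | ∃ (a : ℂ) (γ : Fin d' → ℝ) (f : (Fin (d' + d'') → ℝ) → ℂ),
        (∀ l, 0 ≤ γ l) ∧ SS f ∧ u = fun t => a * HP γ c f t},
        Set.EqOn g (pd j u) (Rpos (d' + d'')) := by
      rintro _ ⟨a, γ, f, hγ, hf, rfl⟩ j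
      have e : Set.EqOn (pd j fun t => a * HP γ c f t) (fun t => a * pd j (HP γ c f) t)
          (Rpos (d' + d'')) := fun t ht => by
        simp only [pd]
        rw [fderiv_const_mul (hasFDerivAt_HP hf hγ hc ht).differentiableAt]
        rfl
      revert e
      refine Fin.addCases (fun l e => ?_) (fun k e => ?_) j
      · refine ⟨_, ⟨a * -(c l : ℂ), inc γ l, f, inc_nonneg hγ l, hf, rfl⟩, fun t ht => ?_⟩
        rw [e ht]
        simp only [pd_castAdd_HP hf hγ hc l ht, mul_assoc]
      · refine ⟨_, ⟨a, γ, _, hγ, hf.pd (Fin.natAdd d' k), rfl⟩, fun t ht => ?_⟩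
        rw [e ht]
        simp only [pd_natAdd_HP hf hγ hc k ht]
    refine SS.of_invariant _ (Smooth.of_invariant _ ?_ hinv) ?_ hinv
    · rintro _ ⟨a, γ, f, hγ, hf, rfl⟩ t ht
      exact (hasFDerivAt_HP hf hγ hc ht).differentiableAt.const_mul a
    · rintro _ ⟨a, γ, f, hγ, hf, rfl⟩
      exact (good_HP hf hγ hc).const_mul a
  have := main _ ⟨1, γ, f, hγ, hf, rfl⟩
  simpa using this

end deriv

section mixed

lemma mderiv_const_mul {d : ℕ} {f : (Fin d → ℝ) → ℂ} (hf : Smooth f) (a : ℂ) (p : Fin d → ℕ) :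
    Set.EqOn (mderiv p fun x => a * f x) (fun x => a * mderiv p f x) (Rpos d) := by
  induction p using multiindex_induction with
  | h0 => rw [mderiv_zero, mderiv_zero]; exact fun _ _ => rfl
  | hs p j ih =>
    refine (pd_mderiv (hf.const_mul a) p j).symm.trans ((pd_congr ih j).trans
      ((pd_const_mul (hf.mderiv p) a j).trans fun x hx => ?_))
    simp only [pd_mderiv hf p j hx]

variable {d' d'' : ℕ} {γ c : Fin d' → ℝ} {f : (Fin (d' + d'') → ℝ) → ℂ}

/-- The order `γ` raised by a multi-index. -/
def shift (γ : Fin d' → ℝ) (q : Fin d' → ℕ) : Fin d' → ℝ := fun l => γ l + q l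

lemma shift_zero (γ : Fin d' → ℝ) : shift γ 0 = γ := by ext l; simp [shift]

lemma shift_add_single (γ : Fin d' → ℝ) (q : Fin d' → ℕ) (l : Fin d') :
    shift γ (q + Pi.single l 1) = inc (shift γ q) l := by
  ext i
  by_cases h : i = l
  · subst h; simp [shift, inc, add_assoc]
  · simp [shift, inc, h]

lemma shift_nonneg (hγ : ∀ l, 0 ≤ γ l) (q : Fin d' → ℕ) : ∀ l, 0 ≤ shift γ q l := fun l =>
  add_nonneg (hγ l) (Nat.cast_nonneg _)

lemma append_add_single_left (q : Fin d' → ℕ) (r : Fin d'' → ℕ) (l : Fin d') :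
    Fin.append (q + Pi.single l 1) r = Fin.append q r + Pi.single (Fin.castAdd d'' l) 1 := by
  ext i
  refine Fin.addCases (fun m => ?_) (fun j => ?_) i
  · simp [Pi.single_apply]
  · have h : Fin.natAdd d' j ≠ Fin.castAdd d'' l := fun h => by
      have := congrArg Fin.val h; simp at this; have := l.2; omega
    simp [h]

lemma append_add_single_right (q : Fin d' → ℕ) (r : Fin d'' → ℕ) (j : Fin d'') :
    Fin.append q (r + Pi.single j 1) = Fin.append q r + Pi.single (Fin.natAdd d' j) 1 := by
  ext i
  refine Fin.addCases (fun l => ?_) (fun m => ?_) i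
  · have h : Fin.castAdd d'' l ≠ Fin.natAdd d' j := fun h => by
      have := congrArg Fin.val h; simp at this; have := l.2; omega
    simp [h]
  · simp [Pi.single_apply]

lemma mderiv_left_HP (hf : SS f) (hγ : ∀ l, 0 ≤ γ l) (hc : ∀ l, 0 < c l) (q : Fin d' → ℕ) :
    Set.EqOn (mderiv (Fin.append q (0 : Fin d'' → ℕ)) (HP γ c f))
      (fun t => (∏ l, (-(c l : ℂ)) ^ q l) * HP (shift γ q) c f t) (Rpos (d' + d'')) := by
  induction q using multiindex_induction with
  | h0 =>
    have : Fin.append (0 : Fin d' → ℕ) (0 : Fin d'' → ℕ) = 0 := by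
      ext i; refine Fin.addCases (fun l => ?_) (fun j => ?_) i <;> simp
    intro t _
    simp [this, mderiv_zero, shift_zero]
  | hs q l ih =>
    have hS := shift_nonneg hγ q
    rw [append_add_single_left]
    refine (pd_mderiv (SS_HP hf hγ hc).smooth _ _).symm.trans ((pd_congr ih _).trans
      ((pd_const_mul (SS_HP hf hS hc).smooth _ _).trans fun t ht => ?_))
    simp only [pd_castAdd_HP hf hS hc l ht, shift_add_single, Pi.add_apply, pow_add,
      Finset.prod_mul_distrib]
    have : ∏ i, (-(c i : ℂ)) ^ (Pi.single l 1 : Fin d' → ℕ) i = -(c l : ℂ) := by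
      rw [Finset.prod_eq_single l] <;> simp +contextual
    rw [this]
    ring

lemma mderiv_HP (hf : SS f) (hγ : ∀ l, 0 ≤ γ l) (hc : ∀ l, 0 < c l) (q : Fin d' → ℕ)
    (r : Fin d'' → ℕ) :
    Set.EqOn (mderiv (Fin.append q r) (HP γ c f))
      (fun t => (∏ l, (-(c l : ℂ)) ^ q l) *
        HP (shift γ q) c (mderiv (Fin.append (0 : Fin d' → ℕ) r) f) t) (Rpos (d' + d'')) := by
  induction r using multiindex_induction with
  | h0 =>
    have : Fin.append (0 : Fin d' → ℕ) (0 : Fin d'' → ℕ) = 0 := by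
      ext i; refine Fin.addCases (fun l => ?_) (fun j => ?_) i <;> simp
    rw [this, mderiv_zero]
    exact mderiv_left_HP hf hγ hc q
  | hs r j ih =>
    have hS := shift_nonneg hγ q
    have hm := hf.mderiv (Fin.append (0 : Fin d' → ℕ) r)
    rw [append_add_single_right, append_add_single_right]
    refine (pd_mderiv (SS_HP hf hγ hc).smooth _ _).symm.trans ((pd_congr ih _).trans
      ((pd_const_mul (SS_HP hm hS hc).smooth _ _).trans fun t ht => ?_))
    simp only [pd_natAdd_HP hm hS hc j ht, HP_congr (pd_mderiv hf.smooth _ _) ht]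

lemma norm_HP_mderiv (hf : SS f) (hγ : ∀ l, 0 ≤ γ l) (hc : ∀ l, 0 < c l) (q : Fin d' → ℕ)
    (r : Fin d'' → ℕ) {t : Fin (d' + d'') → ℝ} (ht : t ∈ Rpos (d' + d'')) :
    ‖HP (shift γ q) c (mderiv (Fin.append q r) f) t‖ =
      ‖HP γ c (mderiv (Fin.append (0 : Fin d' → ℕ) r) f) t‖ := by
  induction q using multiindex_induction with
  | h0 => rw [shift_zero]
  | hs q l ih =>
    rw [append_add_single_left, shift_add_single, ← HP_congr (pd_mderiv hf.smooth _ _) ht,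
      HP_inc_pd (hf.mderiv _) (shift_nonneg hγ q) hc l ht, norm_neg, ih]

lemma norm_mderiv_HP (hf : SS f) (hγ : ∀ l, 0 ≤ γ l) (hc : ∀ l, 0 < c l) (q s : Fin d' → ℕ)
    (r : Fin d'' → ℕ) {t : Fin (d' + d'') → ℝ} (ht : t ∈ Rpos (d' + d'')) :
    ‖mderiv (Fin.append q r) (HP γ c f) t‖ =
      (∏ l, c l ^ q l) * ‖HP (shift (shift γ q) s) c (mderiv (Fin.append s r) f) t‖ := by
  rw [norm_HP_mderiv hf (shift_nonneg hγ q) hc s r ht]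
  have h := mderiv_HP hf hγ hc q r ht
  simp only at h
  rw [h, norm_mul, norm_prod]
  congr 1
  refine Finset.prod_congr rfl fun l _ => ?_
  rw [norm_pow, norm_neg, Complex.norm_real, Real.norm_of_nonneg (hc l).le]

end mixed

section fubini
variable {d' d'' : ℕ}

lemma Good.integrable_norm_sq {d : ℕ} {g : (Fin d → ℝ) → ℂ} (hg : Good g) {δ : Fin d → ℝ}
    (hδ : ∀ l, 0 ≤ δ l) : IntegrableOn (fun t => pw δ t * ‖g t‖ ^ 2) (Rpos d) := by
  obtain ⟨C, hC⟩ := hg.2 0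
  have hRD : RD g := ⟨hg.continuousOn_Rpos, hg.2⟩
  have hi := (hRD.integrable hδ).norm
  refine Integrable.mono' (hi.const_mul C) ?_ ?_
  · exact (((continuousOn_pw δ).mul (hg.continuousOn_Rpos.norm.pow 2)).aestronglyMeasurable
      (measurableSet_Rpos d))
  filter_upwards [ae_restrict_mem (measurableSet_Rpos d)] with t ht
  have h0 := pw_nonneg (γ := δ) fun i => (ht i).le
  have h1 : ‖g t‖ ≤ C := by simpa using hC t ht
  rw [norm_mul, norm_mul, Complex.norm_real, Real.norm_of_nonneg h0, norm_pow, norm_norm]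
  nlinarith [mul_le_mul_of_nonneg_left h1 (mul_nonneg h0 (norm_nonneg (g t)))]

/-- Concatenation of coordinate blocks as a measurable equivalence. -/
def appendEquiv (d' d'' : ℕ) : ((Fin d' → ℝ) × (Fin d'' → ℝ)) ≃ᵐ (Fin (d' + d'') → ℝ) where
  toFun q := Fin.append q.1 q.2
  invFun t := (tl t, tr t)
  left_inv q := by simp [tl_append, tr_append]
  right_inv t := by
    ext i; refine Fin.addCases (fun l => ?_) (fun j => ?_) i <;> simp [tl, tr]
  measurable_toFun := by
    refine measurable_pi_lambda _ fun i => ?_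
    refine Fin.addCases (fun l => ?_) (fun j => ?_) i
    · simpa using (show Measurable fun q : (Fin d' → ℝ) × (Fin d'' → ℝ) => q.1 l by fun_prop)
    · simpa using (show Measurable fun q : (Fin d' → ℝ) × (Fin d'' → ℝ) => q.2 j by fun_prop)
  measurable_invFun := (continuous_tl.prodMk continuous_tr).measurable

lemma appendEquiv_apply (x : Fin d' → ℝ) (y : Fin d'' → ℝ) :
    appendEquiv d' d'' (x, y) = Fin.append x y := rfl

lemma measurePreserving_appendEquiv (μ : Measure ℝ) [SigmaFinite μ] :
    MeasurePreserving (appendEquiv d' d'')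
      ((Measure.pi fun _ => μ).prod (Measure.pi fun _ => μ)) (Measure.pi fun _ => μ) := by
  refine ⟨(appendEquiv d' d'').measurable, (Measure.pi_eq fun s _ => ?_).symm⟩
  rw [MeasurableEquiv.map_apply]
  have : appendEquiv d' d'' ⁻¹' Set.pi Set.univ s =
      (Set.pi Set.univ fun l => s (Fin.castAdd d'' l)) ×ˢ
        (Set.pi Set.univ fun j => s (Fin.natAdd d' j)) := by
    ext ⟨x, y⟩
    simp only [Set.mem_preimage, appendEquiv_apply, Set.mem_pi, Set.mem_univ, true_imp_iff,
      Set.mem_prod]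
    constructor
    · intro h
      exact ⟨fun l => by simpa using h (Fin.castAdd d'' l),
        fun j => by simpa using h (Fin.natAdd d' j)⟩
    · rintro ⟨h1, h2⟩ i
      refine Fin.addCases (fun l => ?_) (fun j => ?_) i
      · simpa using h1 l
      · simpa using h2 j
  rw [this, Measure.prod_prod, Measure.pi_pi, Measure.pi_pi, Fin.prod_univ_add]

lemma setIntegral_append {g : (Fin (d' + d'') → ℝ) → ℝ} (hg : IntegrableOn g (Rpos (d' + d''))) :
    ∫ t in Rpos (d' + d''), g t =
      ∫ y in Rpos d'', ∫ x in Rpos d', g (Fin.append x y) := by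
  have hm := measurePreserving_appendEquiv (d' := d') (d'' := d'')
    (volume.restrict (Set.Ioi (0 : ℝ)))
  rw [IntegrableOn, restrict_Rpos] at hg
  simp only [restrict_Rpos]
  rw [← hm.integral_comp', integral_prod_symm]
  · rfl
  · exact (hm.integrable_comp_emb (appendEquiv d' d'').measurableEmbedding).2 hg

lemma pw_append (α : Fin d' → ℝ) (β : Fin d'' → ℝ) (x : Fin d' → ℝ) (y : Fin d'' → ℝ) :
    pw (Fin.append α β) (Fin.append x y) = pw α x * pw β y := by
  simp [pw, Fin.prod_univ_add]

lemma HP_append (γ c : Fin d' → ℝ) (f : (Fin (d' + d'') → ℝ) → ℂ) (x : Fin d' → ℝ)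
    (y : Fin d'' → ℝ) :
    HP γ c f (Fin.append x y) = HT γ c (fun x => f (Fin.append x y)) x := by
  simp only [HP, tl_append, tr_append]

/-- Plancherel identity for the partial transform. -/
lemma HP_plancherel {α c : Fin d' → ℝ} {β : Fin d'' → ℝ} {g : (Fin (d' + d'') → ℝ) → ℂ}
    (hg : SS g) (hα : ∀ l, 0 ≤ α l) (hβ : ∀ j, 0 ≤ β j) (hc : ∀ l, 0 < c l) :
    ∫ t in Rpos (d' + d''), pw (Fin.append α β) t * ‖HP α c g t‖ ^ 2 =
      (∏ l, c l ^ (-(α l + 1))) *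
        ∫ t in Rpos (d' + d''), pw (Fin.append α β) t * ‖g t‖ ^ 2 := by
  have hδ : ∀ i, 0 ≤ Fin.append α β i := fun i =>
    Fin.addCases (fun l => by simpa using hα l) (fun j => by simpa using hβ j) i
  have hH := SS_HP hg hα hc
  rw [setIntegral_append (hH.good.integrable_norm_sq hδ),
    setIntegral_append (hg.good.integrable_norm_sq hδ), ← integral_const_mul]
  refine setIntegral_congr_fun (measurableSet_Rpos d'') fun y hy => ?_
  simp only [pw_append, HP_append]
  have hR := hH.good.slice hy
  simp only [HP_append] at hR
  have h := HT_plancherel hα hc (hg.good.slice hy) hR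
  have e : ∀ (u : (Fin d' → ℝ) → ℝ), ∫ x in Rpos d', pw α x * pw β y * u x =
      pw β y * ∫ x in Rpos d', pw α x * u x := fun u => by
    rw [← integral_const_mul]; congr 1; ext x; ring
  rw [e fun x => ‖HT α c (fun x => g (Fin.append x y)) x‖ ^ 2,
    e fun x => ‖g (Fin.append x y)‖ ^ 2, h]
  ring

end fubini

section fractional
variable {d' d'' : ℕ}

lemma div_one_sub_sq {z : ℂ} (h1 : ‖z‖ = 1) (h2 : z ≠ 1) :
    z / (1 - z) ^ 2 = -(((‖1 - z‖ ^ 2)⁻¹ : ℝ) : ℂ) := by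
  have h0 : 1 - z ≠ 0 := sub_ne_zero.2 h2.symm
  have hz : z * (starRingEnd ℂ) z = 1 := by rw [Complex.mul_conj']; simp [h1]
  have hn : ((‖1 - z‖ ^ 2 : ℝ) : ℂ) = (1 - z) * (starRingEnd ℂ) (1 - z) := by
    rw [Complex.mul_conj']; push_cast; rfl
  have hne : (starRingEnd ℂ) (1 - z) ≠ 0 := (map_ne_zero _).2 h0
  push_cast at hn ⊢
  rw [hn, map_sub, map_one] at *
  field_simp
  linear_combination (-1 : ℂ) * hz

lemma Jpart_eq {z : Fin d' → ℂ} (hz : ∀ l, ‖z l‖ = 1 ∧ z l ≠ 1) (γ : Fin d' → ℝ)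
    (f : (Fin (d' + d'') → ℝ) → ℂ) (t : Fin (d' + d'') → ℝ) :
    Jpart z γ f t = (∏ l, (1 - z l) ^ ((-1 : ℂ) - (γ l : ℂ))) *
      HP γ (fun l => (‖1 - z l‖ ^ 2)⁻¹) f t := by
  unfold Jpart HP HT
  congr 1
  refine setIntegral_congr_fun (measurableSet_Rpos d') fun x hx => ?_
  simp only
  rw [mul_comm]
  congr 1
  simp only [pw, kb, tl]
  rw [← Finset.prod_mul_distrib, Complex.ofReal_prod]
  refine Finset.prod_congr rfl fun l _ => ?_
  rw [mul_div_assoc, div_one_sub_sq (hz l).1 (hz l).2, Complex.ofReal_mul,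
    Complex.ofReal_cpow (hx l).le, ← Kfun_neg_ofReal]
  congr 2
  push_cast
  ring

lemma norm_one_sub_cpow {z : ℂ} (h : z ≠ 1) (γ : ℝ) :
    ‖(1 - z) ^ ((-1 : ℂ) - (γ : ℂ))‖ = ‖1 - z‖ ^ (-1 - γ) := by
  have h0 : 1 - z ≠ 0 := sub_ne_zero.2 h.symm
  rw [show (-1 : ℂ) - (γ : ℂ) = ((-1 - γ : ℝ) : ℂ) by push_cast; ring]
  rw [Complex.norm_cpow_of_ne_zero h0]
  simp

lemma wt_sq (γ : Fin d' → ℝ) (p k : Fin (d' + d'') → ℕ) {t : Fin (d' + d'') → ℝ}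
    (ht : t ∈ Rpos (d' + d'')) :
    wt γ p k t ^ 2 = pw (Fin.append
      (shift (shift γ fun l => k (Fin.castAdd d'' l)) fun l => p (Fin.castAdd d'' l))
      (fun j => (p (Fin.natAdd d' j) : ℝ) + k (Fin.natAdd d' j))) t := by
  have h : ∀ (i : Fin (d' + d'')) (s : ℝ), (t i ^ (s / 2)) ^ 2 = t i ^ s := fun i s => by
    rw [← Real.rpow_mul_natCast (ht i).le]; congr 1; push_cast; ring
  rw [wt, mul_pow, ← Finset.prod_pow, ← Finset.prod_pow, pw, Fin.prod_univ_add]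
  simp only [h, Fin.append_left, Fin.append_right, shift]
  congr 1
  refine Finset.prod_congr rfl fun l _ => ?_
  congr 1
  ring

lemma scaling_constant {a : ℝ} (ha : 0 < a) (γ : ℝ) (p k : ℕ) :
    (a ^ (-(p : ℝ) + (k : ℝ))) ^ 2 * ((a ^ (-1 - γ) * (a ^ 2)⁻¹ ^ k) ^ 2 *
      (a ^ 2)⁻¹ ^ (-(γ + k + p + 1))) = 1 := by
  have e1 : (a ^ 2)⁻¹ = a ^ (-2 : ℝ) := by rw [Real.rpow_neg ha.le]; norm_num
  rw [e1, ← Real.rpow_mul_natCast ha.le, ← Real.rpow_mul_natCast ha.le, ← Real.rpow_add ha,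
    ← Real.rpow_mul_natCast ha.le, ← Real.rpow_mul ha.le, ← Real.rpow_add ha, ← Real.rpow_add ha]
  convert Real.rpow_zero a using 2
  push_cast
  ring

end fractional

/-- The partial transform `J^{(d')}_{z',γ'}` maps `S(ℝ^{d'+d''}₊)` into itself and satisfies
`‖t'^{(p'+k'+γ')/2} t''^{(p''+k'')/2} D^p f‖₂ = ∏|1−z_l|^{−p_l+k_l} ·
‖t'^{(p'+k'+γ')/2} t''^{(p''+k'')/2} D^{k'}_{t'} D^{p''}_{t''} J^{(d')}_{z',γ'} f‖₂`. -/
theorem stmt7 {d' d'' : ℕ} (γ : Fin d' → ℝ) (hγ : ∀ l, 0 ≤ γ l)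
    (z : Fin d' → ℂ) (hz : ∀ l, ‖z l‖ = 1 ∧ z l ≠ 1)
    (f : (Fin (d' + d'') → ℝ) → ℂ) (hf : IsSPlus f) :
    IsSPlus (Jpart z γ f) ∧
    ∀ p k : Fin (d' + d'') → ℕ,
      Real.sqrt (∫ t in Rpos (d' + d''), (wt γ p k t * ‖mderiv p f t‖)^2)
        = (∏ l : Fin d', ‖1 - z l‖ ^
              (-(p (Fin.castAdd d'' l) : ℝ) + (k (Fin.castAdd d'' l) : ℝ))) *
          Real.sqrt (∫ t in Rpos (d' + d''),
            (wt γ p k t *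
              ‖mderiv (Fin.append (fun l => k (Fin.castAdd d'' l))
                  (fun l => p (Fin.natAdd d' l))) (Jpart z γ f) t‖)^2) := by
  have hs := hf.ss
  have ha : ∀ l, 0 < ‖1 - z l‖ := fun l => norm_pos_iff.2 (sub_ne_zero.2 (hz l).2.symm)
  set c : Fin d' → ℝ := fun l => (‖1 - z l‖ ^ 2)⁻¹ with hc_def
  have hc : ∀ l, 0 < c l := fun l => inv_pos.2 (pow_pos (ha l) 2)
  set A : ℂ := ∏ l, (1 - z l) ^ ((-1 : ℂ) - (γ l : ℂ)) with hA
  have hJ : Jpart z γ f = fun t => A * HP γ c f t := funext fun t => Jpart_eq hz γ f t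
  have hH := SS_HP hs hγ hc
  rw [hJ]
  refine ⟨(hH.const_mul A).isSPlus, fun p k => ?_⟩
  set k' : Fin d' → ℕ := fun l => k (Fin.castAdd d'' l) with hk'
  set p' : Fin d' → ℕ := fun l => p (Fin.castAdd d'' l) with hp'
  set p'' : Fin d'' → ℕ := fun j => p (Fin.natAdd d' j) with hp''
  set α := shift (shift γ k') p' with hα
  set δ := Fin.append α (fun j : Fin d'' => (p (Fin.natAdd d' j) : ℝ) + k (Fin.natAdd d' j))
    with hδ
  have hp : Fin.append p' p'' = p := by
    ext i; refine Fin.addCases (fun l => ?_) (fun j => ?_) i <;> simp [hp', hp'']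
  set I := ∫ t in Rpos (d' + d''), pw δ t * ‖mderiv p f t‖ ^ 2 with hI
  have e1 : ∫ t in Rpos (d' + d''), (wt γ p k t * ‖mderiv p f t‖) ^ 2 = I :=
    setIntegral_congr_fun (measurableSet_Rpos _) fun t ht => by
      simp only [mul_pow, wt_sq γ p k ht, hδ, hα, hk', hp']
  have e2 : ∫ t in Rpos (d' + d''),
      (wt γ p k t * ‖mderiv (Fin.append k' p'') (fun t => A * HP γ c f t) t‖) ^ 2 =
      (‖A‖ * ∏ l, c l ^ k' l) ^ 2 * ((∏ l, c l ^ (-(α l + 1))) * I) := by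
    rw [hI, hδ, ← HP_plancherel (hs.mderiv p) (shift_nonneg (shift_nonneg hγ k') p')
      (fun j => by positivity) hc, ← integral_const_mul]
    refine setIntegral_congr_fun (measurableSet_Rpos _) fun t ht => ?_
    have h1 := mderiv_const_mul hH.smooth A (Fin.append k' p'') ht
    have h2 := norm_mderiv_HP hs hγ hc k' p' p'' ht
    simp only at h1 ⊢
    rw [hp] at h2
    rw [h1, norm_mul, h2, mul_pow, wt_sq γ p k ht]
    ring
  have hAn : ‖A‖ = ∏ l, ‖1 - z l‖ ^ (-1 - γ l) := by
    rw [hA, norm_prod]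
    exact Finset.prod_congr rfl fun l _ => norm_one_sub_cpow (hz l).2 (γ l)
  have hB : 0 ≤ ∏ l, ‖1 - z l‖ ^ (-(p (Fin.castAdd d'' l) : ℝ) + (k (Fin.castAdd d'' l) : ℝ)) :=
    Finset.prod_nonneg fun l _ => Real.rpow_nonneg (norm_nonneg _) _
  rw [e1, e2]
  conv_rhs => rw [← Real.sqrt_sq hB, ← Real.sqrt_mul (sq_nonneg _)]
  congr 1
  rw [← mul_assoc, hAn, ← Finset.prod_mul_distrib,
    ← Finset.prod_pow, ← Finset.prod_pow, ← Finset.prod_mul_distrib, ← mul_assoc,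
    ← Finset.prod_mul_distrib]
  rw [Finset.prod_eq_one, one_mul]
  exact fun l _ => (mul_assoc _ _ _).trans (scaling_constant (ha l) (γ l) (p' l) (k' l))
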